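/- Let G be a group generated by a finite set A, with word metric d_A. Then G is virtually free if and only if there exists δ ≥ 0 such that every discrete geodesic polygon in G is δ-thin, i.e., for every closed cycle of discrete geodesics γ₀, γ₁, …, γₙ (n ≥ 1, the endpoint of each γᵢ equal to the starting point of γᵢ₊₁, indices modulo n+1), every vertex of γₙ lies within d_A-distance δ of some vertex of γ₀, …, γₙ₋₁. -/

import Mathlib

/-- The word metric associated with a generating set `A` of a group `G`:
`wordDist A g h` is the least `n` such that `g⁻¹h` is a product of `n` elements
of `A ∪ A⁻¹`. -/
noncomputable def wordDist {G : Type*} [Group G] (A : Set G) (g h : G) : ℕ :=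
  sInf { n : ℕ | ∃ l : List G, l.length = n ∧ (∀ x ∈ l, x ∈ A ∪ A⁻¹) ∧ l.prod = g⁻¹ * h }

/-- A group is virtually free if it has a free subgroup of finite index. -/
def VirtuallyFree (G : Type*) [Group G] : Prop :=
  ∃ H : Subgroup G, H.FiniteIndex ∧ IsFreeGroup H
/-- `γ 0, γ 1, …, γ m` is a discrete geodesic for the word metric of `A`:
`d_A(γ i, γ j) = |i − j|` for all `i, j ≤ m`. -/
def IsDiscGeodesic {G : Type*} [Group G] (A : Set G) (γ : ℕ → G) (m : ℕ) : Prop :=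
  ∀ i ≤ m, ∀ j ≤ m, (wordDist A (γ i) (γ j) : ℤ) = |(i : ℤ) - (j : ℤ)|

/-- `γ 0, γ 1, …, γ m` is a discrete path for the word metric of `A`:
consecutive vertices are at distance at most `1`. -/
def IsDiscPath {G : Type*} [Group G] (A : Set G) (γ : ℕ → G) (m : ℕ) : Prop :=
  ∀ i < m, wordDist A (γ i) (γ (i + 1)) ≤ 1
/-- A discrete geodesic polygon: a closed cycle of `n + 1` discrete geodesics
(`n ≥ 1`), the endpoint of each equal to the starting point of the next. -/
structure DiscPolygon (G : Type*) [Group G] (A : Set G) where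
  n : ℕ
  one_le_n : 1 ≤ n
  m : ℕ → ℕ
  γ : ℕ → ℕ → G
  geodesic : ∀ i ≤ n, IsDiscGeodesic A (γ i) (m i)
  chain : ∀ i < n, γ i (m i) = γ (i + 1) 0
  closed : γ n (m n) = γ 0 0

namespace VirtuallyFreePolygons

section CayleyGraph

variable {G : Type*} [Group G]

/-- The (simple, undirected) Cayley graph of `G` with respect to `A`. -/
def cayleyGraph (A : Set G) : SimpleGraph G where
  Adj g h := g ≠ h ∧ g⁻¹ * h ∈ A ∪ A⁻¹
  symm := ⟨by
    rintro g h ⟨hne, hmem⟩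
    refine ⟨hne.symm, ?_⟩
    have : h⁻¹ * g = (g⁻¹ * h)⁻¹ := by group
    rw [this]
    rcases hmem with hm | hm
    · exact Or.inr (by simpa using hm)
    · exact Or.inl (by simpa using hm)⟩
  loopless := ⟨fun g h => h.1 rfl⟩

theorem cayleyGraph_adj_mul_left {A : Set G} (k g h : G) :
    (cayleyGraph A).Adj (k * g) (k * h) ↔ (cayleyGraph A).Adj g h := by
  simp [cayleyGraph, mul_assoc]

theorem exists_walk_of_list {A : Set G} (l : List G) (hl : ∀ x ∈ l, x ∈ A ∪ A⁻¹) (g h : G)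
    (hp : l.prod = g⁻¹ * h) : ∃ w : (cayleyGraph A).Walk g h, w.length ≤ l.length := by
  induction l generalizing g with
  | nil =>
    obtain rfl : g = h := by simpa [inv_mul_eq_one, eq_comm] using hp
    exact ⟨SimpleGraph.Walk.nil, by simp⟩
  | cons a l ih =>
    by_cases ha : a = 1
    · subst ha
      obtain ⟨w, hw⟩ := ih (fun x hx => hl x (List.mem_cons_of_mem _ hx)) g (by simpa using hp)
      exact ⟨w, by simpa using hw.trans (Nat.le_succ _)⟩
    · have hadj : (cayleyGraph A).Adj g (g * a) := ⟨by simpa using ha, by simpa using hl a (by simp)⟩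
      obtain ⟨w, hw⟩ := ih (fun x hx => hl x (List.mem_cons_of_mem _ hx)) (g * a) (by
        rw [List.prod_cons] at hp
        rw [mul_inv_rev, mul_assoc, ← hp, inv_mul_cancel_left])
      exact ⟨SimpleGraph.Walk.cons hadj w, by simpa using hw⟩

theorem exists_list_of_walk {A : Set G} {g h : G} (w : (cayleyGraph A).Walk g h) :
    ∃ l : List G, l.length = w.length ∧ (∀ x ∈ l, x ∈ A ∪ A⁻¹) ∧ l.prod = g⁻¹ * h := by
  induction w with
  | nil => exact ⟨[], by simp⟩
  | @cons u v t hadj w ih =>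
    obtain ⟨l, hl, hA, hp⟩ := ih
    refine ⟨(u⁻¹ * v) :: l, by simp [hl], ?_, by simp [hp, mul_assoc]⟩
    intro x hx
    rcases List.mem_cons.1 hx with rfl | hx
    · exact hadj.2
    · exact hA x hx

theorem cayleyGraph_connected {A : Set G} (hgen : Subgroup.closure A = ⊤) :
    (cayleyGraph A).Connected := by
  have : Nonempty G := ⟨1⟩
  refine SimpleGraph.Connected.mk fun g h => ?_
  have hmem : g⁻¹ * h ∈ (Subgroup.closure A).toSubmonoid := by rw [hgen]; trivial
  rw [Subgroup.closure_toSubmonoid] at hmem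
  obtain ⟨l, hl, hp⟩ := Submonoid.exists_list_of_mem_closure hmem
  exact ⟨(exists_walk_of_list l hl g h hp).choose⟩

theorem wordDist_eq_dist {A : Set G} (hgen : Subgroup.closure A = ⊤) (g h : G) :
    wordDist A g h = (cayleyGraph A).dist g h := by
  have hc := cayleyGraph_connected hgen
  obtain ⟨w, hw⟩ := hc.exists_walk_length_eq_dist g h
  obtain ⟨l, hl, hA, hp⟩ := exists_list_of_walk w
  apply le_antisymm
  · exact Nat.sInf_le ⟨l, by omega, hA, hp⟩
  · obtain ⟨l', hl', hA', hp'⟩ := Nat.sInf_mem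
      (s := { n : ℕ | ∃ l : List G, l.length = n ∧ (∀ x ∈ l, x ∈ A ∪ A⁻¹) ∧ l.prod = g⁻¹ * h })
      ⟨_, l, rfl, hA, hp⟩
    obtain ⟨w', hw'⟩ := exists_walk_of_list l' hA' g h hp'
    exact (((cayleyGraph A).dist_le w').trans hw').trans hl'.le

theorem dist_mul_left {A : Set G} (hgen : Subgroup.closure A = ⊤) (k g h : G) :
    (cayleyGraph A).dist (k * g) (k * h) = (cayleyGraph A).dist g h := by
  rw [← wordDist_eq_dist hgen, ← wordDist_eq_dist hgen]
  simp [wordDist, mul_assoc]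

end CayleyGraph

section Forward

open FreeGroup

theorem head?_toWord_mul_letter {α : Type*} [DecidableEq α] (r : FreeGroup α) (x : α × Bool)
    (h1 : r ≠ 1) (h2 : r * mk [x] ≠ 1) :
    (r * mk [x]).toWord.head? = r.toWord.head? := by
  have hr : FreeGroup.IsReduced r.toWord := isReduced_toWord
  have hrw : mk r.toWord = r := mk_toWord
  rcases List.eq_nil_or_concat r.toWord with hL | ⟨L, y, hL⟩
  · exact absurd (toWord_eq_nil_iff.1 hL) h1
  · rw [List.concat_eq_append] at hL
    have hmul : r * mk [x] = mk (L ++ [y] ++ [x]) := by rw [← hL, ← mul_mk, hrw]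
    by_cases hxy : y.1 = x.1 → y.2 = x.2
    · have hred : FreeGroup.IsReduced (L ++ [y] ++ [x]) := by
        rw [FreeGroup.IsReduced, List.isChain_append]
        refine ⟨hL ▸ hr, List.isChain_singleton _, ?_⟩
        simpa using hxy
      rw [hmul, toWord_mk, hred.reduce_eq, hL]
      cases L <;> simp
    · push Not at hxy
      obtain ⟨h3, h4⟩ := hxy
      have hx : x = (y.1, !y.2) := by
        ext
        · exact h3.symm
        · cases hy : y.2 <;> cases hx : x.2 <;> simp_all
      have hmk : r * mk [x] = mk L := by
        rw [hmul, hx, List.append_assoc]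
        apply Quot.sound
        simpa using (Red.Step.not (L₁ := L) (L₂ := []) (x := y.1) (b := y.2))
      have hLred : FreeGroup.IsReduced L := List.IsChain.left_of_append (hL ▸ hr)
      rw [hmk, toWord_mk, hLred.reduce_eq, hL]
      cases L with
      | nil => exact absurd hmk h2
      | cons => simp

/-- In a free group, right multiplication by `φ` can only change the first letter of `q` if
`q` is the inverse of a prefix of `φ`. -/
theorem exists_take_of_head?_ne {α : Type*} [DecidableEq α] (l : List (α × Bool))
    (q : FreeGroup α) (h : (q * mk l).toWord.head? ≠ q.toWord.head?) :
    ∃ n ≤ l.length, q = (mk (l.take n))⁻¹ := by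
  induction l generalizing q with
  | nil => exact absurd (by simp [← one_eq_mk]) h
  | cons x l ih =>
    by_cases h1 : q = 1
    · exact ⟨0, by simp, by simp [h1, ← one_eq_mk]⟩
    by_cases h2 : q * mk [x] = 1
    · exact ⟨1, by simp, eq_inv_of_mul_eq_one_left h2⟩
    have hsplit : mk (x :: l) = mk [x] * mk l := by rw [mul_mk]; rfl
    obtain ⟨n, hn, hq⟩ := ih (q * mk [x]) (by
      rw [head?_toWord_mul_letter q x h1 h2, mul_assoc, ← hsplit]
      exact h)
    refine ⟨n + 1, by simpa using hn, ?_⟩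
    rw [List.take_succ_cons, show x :: l.take n = [x] ++ l.take n from rfl, ← mul_mk,
      mul_inv_rev, ← hq, mul_inv_cancel_right]

/-- Two elements of a free group are not in a common branch at `1` of the Cayley tree. -/
def Branches {α : Type*} [DecidableEq α] (p r : FreeGroup α) : Prop :=
  p.toWord.head? ≠ r.toWord.head? ∨ p = 1

theorem exists_letter_of_not_branches {α : Type*} [DecidableEq α] {p r : FreeGroup α}
    (h : ¬ Branches p r) : ∃ s : FreeGroup α, s.norm ≤ 1 ∧
      (s * p).norm < p.norm ∧ (s * r).norm < r.norm := by
  rw [Branches, not_or, not_not] at h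
  obtain ⟨h1, h2⟩ := h
  have key : ∀ (q : FreeGroup α) (x : α × Bool), q.toWord.head? = some x →
      ((mk [x])⁻¹ * q).norm < q.norm := by
    intro q x hq
    obtain ⟨t, ht⟩ : ∃ t, q.toWord = x :: t := by
      cases hw : q.toWord with
      | nil => simp [hw] at hq
      | cons y t => exact ⟨t, by simp_all⟩
    have : q = mk [x] * mk t := by
      rw [mul_mk, ← mk_toWord (x := q), ht]; rfl
    calc ((mk [x])⁻¹ * q).norm = (mk t).norm := by rw [this, inv_mul_cancel_left]
      _ ≤ t.length := norm_mk_le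
      _ < q.norm := by simp [FreeGroup.norm, ht]
  cases hp : p.toWord.head? with
  | none =>
    rw [List.head?_eq_none_iff, toWord_eq_nil_iff] at hp
    exact absurd hp h2
  | some x =>
    refine ⟨(mk [x])⁻¹, ?_, key p x hp, key r x (h1 ▸ hp)⟩
    rw [norm_inv_eq]
    exact norm_mk_le

/-- Existence of medians in the Cayley tree of a free group. -/
theorem exists_median {α : Type*} [DecidableEq α] (a b c : FreeGroup α) :
    ∃ w : FreeGroup α, Branches (w * a) (w * b) ∧ Branches (w * b) (w * c) ∧
      Branches (w * c) (w * a) := by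
  obtain ⟨w, hw⟩ : ∃ w : FreeGroup α, ∀ w' : FreeGroup α,
      (w * a).norm + (w * b).norm + (w * c).norm ≤
        (w' * a).norm + (w' * b).norm + (w' * c).norm := by
    have := Function.argmin_le (fun w : FreeGroup α =>
      (w * a).norm + (w * b).norm + (w * c).norm)
    exact ⟨_, fun w' => this w'⟩
  refine ⟨w, ?_, ?_, ?_⟩ <;> by_contra hcon <;>
    obtain ⟨s, hs, h1, h2⟩ := exists_letter_of_not_branches hcon
  · have := norm_mul_le s (w * c)
    have := hw (s * w)
    simp only [mul_assoc] at *
    omega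
  · have := norm_mul_le s (w * a)
    have := hw (s * w)
    simp only [mul_assoc] at *
    omega
  · have := norm_mul_le s (w * b)
    have := hw (s * w)
    simp only [mul_assoc] at *
    omega

/-- A path with steps in a finite set, joining two branches of the Cayley tree of a free group,
visits a given finite set. -/
theorem exists_finite_separator {α : Type*} [DecidableEq α] (Φ : Set (FreeGroup α))
    (hΦ : Φ.Finite) : ∃ S : Set (FreeGroup α), S.Finite ∧ 1 ∈ S ∧
      ∀ q r, q⁻¹ * r ∈ Φ → q ∉ S → q.toWord.head? = r.toWord.head? := by
  refine ⟨insert 1 (⋃ φ ∈ Φ, (fun n => (mk (φ.toWord.take n))⁻¹) '' Set.Iic φ.toWord.length),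
    Set.Finite.insert _ (hΦ.biUnion fun φ _ => (Set.finite_Iic _).image _), by simp, ?_⟩
  intro q r hqr hq
  by_contra hne
  apply hq
  obtain ⟨n, hn, h⟩ := exists_take_of_head?_ne (q⁻¹ * r).toWord q (by
    rw [mk_toWord, mul_inv_cancel_left]
    exact fun h => hne h.symm)
  refine Set.mem_insert_of_mem _ (Set.mem_biUnion hqr ⟨n, hn, h.symm⟩)

theorem head?_eq_of_forall_notMem {α : Type*} [DecidableEq α] {Φ S : Set (FreeGroup α)}
    (hS : ∀ q r, q⁻¹ * r ∈ Φ → q ∉ S → q.toWord.head? = r.toWord.head?) (f : ℕ → FreeGroup α)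
    {a b : ℕ} (hab : a ≤ b) (hstep : ∀ i, a ≤ i → i < b → (f i)⁻¹ * f (i + 1) ∈ Φ)
    (hf : ∀ i, a ≤ i → i ≤ b → f i ∉ S) : (f a).toWord.head? = (f b).toWord.head? := by
  induction b, hab using Nat.le_induction with
  | base => rfl
  | succ b hab ih =>
    rw [ih (fun i h1 h2 => hstep i h1 (by omega)) (fun i h1 h2 => hf i h1 (by omega))]
    exact hS _ _ (hstep b hab (by omega)) (hf b hab (by omega))

theorem step_mem_of_isDiscGeodesic {G : Type*} [Group G] {A : Set G}
    (hgen : Subgroup.closure A = ⊤) {γ : ℕ → G} {m : ℕ} (h : IsDiscGeodesic A γ m) {i : ℕ}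
    (hi : i < m) : (γ i)⁻¹ * γ (i + 1) ∈ A ∪ A⁻¹ := by
  have h1 := h i hi.le (i + 1) (by omega)
  rw [wordDist_eq_dist hgen] at h1
  have h2 : (cayleyGraph A).dist (γ i) (γ (i + 1)) = 1 := by
    have : |(i : ℤ) - ((i + 1 : ℕ) : ℤ)| = 1 := by push_cast; simp
    omega
  exact (SimpleGraph.dist_eq_one_iff_adj.1 h2).2

theorem thin_of_virtuallyFree {G : Type*} [Group G] (A : Set G) (hA : A.Finite)
    (hgen : Subgroup.closure A = ⊤) (hG : VirtuallyFree G) :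
    ∃ δ : ℝ, 0 ≤ δ ∧ ∀ P : DiscPolygon G A, ∀ t ≤ P.m P.n,
      ∃ j < P.n, ∃ u ≤ P.m j, (wordDist A (P.γ P.n t) (P.γ j u) : ℝ) ≤ δ := by
  classical
  obtain ⟨H, hfin, hfree⟩ := hG
  set τ : G → G := fun g => ((g⁻¹ : G) : G ⧸ H).out with hτ
  have hτmem : ∀ g, g * τ g ∈ H := fun g => by
    obtain ⟨h, hh⟩ := QuotientGroup.mk_out_eq_mul H g⁻¹
    rw [hτ]
    simp only [hh, mul_inv_cancel_left, SetLike.coe_mem]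
  have hT : (Set.range τ).Finite :=
    (Set.finite_range (fun x : G ⧸ H => x.out)).subset (by rintro _ ⟨g, rfl⟩; exact ⟨_, rfl⟩)
  set π : G → H := fun g => ⟨g * τ g, hτmem g⟩ with hπ
  set e := IsFreeGroup.toFreeGroup H
  have hAA : (A ∪ A⁻¹).Finite := hA.union hA.inv
  have hinj : Function.Injective (fun φ => ((e.symm φ : H) : G)) :=
    Subtype.val_injective.comp e.symm.injective
  set Φ : Set (FreeGroup (IsFreeGroup.Generators H)) := (fun φ => ((e.symm φ : H) : G)) ⁻¹'
    ((fun p : G × G × G => p.1⁻¹ * p.2.1 * p.2.2) '' (Set.range τ ×ˢ (A ∪ A⁻¹) ×ˢ Set.range τ))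
    with hΦdef
  have hΦ : Φ.Finite := ((hT.prod (hAA.prod hT)).image _).preimage hinj.injOn
  obtain ⟨S, hSfin, hS1, hS⟩ := exists_finite_separator Φ hΦ
  have hquot : ∀ w a b, e.symm ((w * e a)⁻¹ * (w * e b)) = a⁻¹ * b := by
    intro w a b
    rw [mul_inv_rev, mul_assoc, inv_mul_cancel_left, ← _root_.map_inv, ← _root_.map_mul,
      MulEquiv.symm_apply_apply]
  have hstep : ∀ w g g', g⁻¹ * g' ∈ A ∪ A⁻¹ → (w * e (π g))⁻¹ * (w * e (π g')) ∈ Φ := by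
    intro w g g' hgg
    refine ⟨(τ g, g⁻¹ * g', τ g'), ⟨⟨g, rfl⟩, hgg, ⟨g', rfl⟩⟩, ?_⟩
    simp only [hquot]
    simp only [hπ, mul_inv_rev, mul_assoc, Subgroup.coe_mul, Subgroup.coe_inv]
  set R : Set G := (fun p : (G × G) × (FreeGroup (IsFreeGroup.Generators H) ×
      FreeGroup (IsFreeGroup.Generators H)) =>
      p.1.1 * ((e.symm (p.2.1⁻¹ * p.2.2) : H) : G) * (p.1.2)⁻¹) ''
      ((Set.range τ ×ˢ Set.range τ) ×ˢ (S ×ˢ S)) with hR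
  have hRfin : R.Finite := ((hT.prod hT).prod (hSfin.prod hSfin)).image _
  obtain ⟨c, hc⟩ : ∃ c : ℕ, ∀ r ∈ R, wordDist A 1 r ≤ c := by
    obtain ⟨c, hc⟩ := (hRfin.image (wordDist A 1)).bddAbove
    exact ⟨c, fun r hr => hc ⟨r, hr, rfl⟩⟩
  have hclose : ∀ w x y, w * e (π x) ∈ S → w * e (π y) ∈ S → wordDist A x y ≤ c := by
    intro w x y hx hy
    have : wordDist A x y = wordDist A 1 (x⁻¹ * y) := by simp [wordDist]
    rw [this]
    refine hc _ ⟨((τ x, τ y), (_, _)), ⟨⟨⟨x, rfl⟩, ⟨y, rfl⟩⟩, hx, hy⟩, ?_⟩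
    simp only [hquot]
    simp only [hπ, mul_inv_rev, mul_assoc, Subgroup.coe_mul, Subgroup.coe_inv, mul_inv_cancel_left,
      mul_inv_cancel, mul_one]
  refine ⟨(2 * c : ℕ), by positivity, fun P t ht => ?_⟩
  have hgeo := P.geodesic P.n le_rfl
  obtain ⟨w, h1, h2, h3⟩ := exists_median (e (π (P.γ P.n 0))) (e (π (P.γ P.n t)))
    (e (π (P.γ P.n (P.m P.n))))
  have contra : ∀ {p r : FreeGroup (IsFreeGroup.Generators H)}, Branches p r → p ∉ S →
      p.toWord.head? = r.toWord.head? → False := by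
    rintro p r (hb | rfl) hp hpr
    · exact hb hpr
    · exact hp hS1
  obtain ⟨i, hit, hi⟩ : ∃ i ≤ t, w * e (π (P.γ P.n i)) ∈ S := by
    by_contra! hcon
    refine contra h1 (hcon 0 (by omega)) ?_
    exact head?_eq_of_forall_notMem hS (fun i => w * e (π (P.γ P.n i))) (Nat.zero_le t)
      (fun i _ hi => hstep _ _ _ (step_mem_of_isDiscGeodesic hgen hgeo (by omega))) (fun i _ hi => hcon i hi)
  obtain ⟨j, htj, hjm, hj⟩ : ∃ j, t ≤ j ∧ j ≤ P.m P.n ∧ w * e (π (P.γ P.n j)) ∈ S := by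
    by_contra! hcon
    refine contra h2 (hcon t le_rfl ht) ?_
    exact head?_eq_of_forall_notMem hS (fun i => w * e (π (P.γ P.n i))) ht
      (fun i _ hi => hstep _ _ _ (step_mem_of_isDiscGeodesic hgen hgeo (by omega)))
      (fun i hi hi' => hcon i hi hi')
  obtain ⟨k, hk, u, hu, hku⟩ : ∃ k < P.n, ∃ u ≤ P.m k, w * e (π (P.γ k u)) ∈ S := by
    by_contra! hcon
    have hside : ∀ k < P.n, ∀ u ≤ P.m k, (w * e (π (P.γ k 0))).toWord.head? =
        (w * e (π (P.γ k u))).toWord.head? := fun k hk u hu =>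
      head?_eq_of_forall_notMem hS (fun i => w * e (π (P.γ k i))) (Nat.zero_le u)
        (fun i _ hi => hstep _ _ _ (step_mem_of_isDiscGeodesic hgen (P.geodesic k hk.le) (by omega)))
        (fun i _ hi => hcon k hk i (hi.trans hu))
    have hall : ∀ k ≤ P.n, (w * e (π (P.γ 0 0))).toWord.head? =
        (w * e (π (P.γ k 0))).toWord.head? := by
      intro k
      induction k with
      | zero => exact fun _ => rfl
      | succ k ih =>
        intro hk
        rw [ih (by omega), hside k (by omega) _ le_rfl, P.chain k (by omega)]
    refine contra h3 ?_ ?_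
    · rw [P.closed]
      exact hcon 0 P.one_le_n 0 (Nat.zero_le _)
    · rw [P.closed]
      exact hall P.n le_rfl
  refine ⟨k, hk, u, hu, ?_⟩
  have hij := hclose w _ _ hi hj
  have hik := hclose w _ _ hi hku
  have e1 := hgeo i (by omega) j hjm
  have e2 := hgeo i (by omega) t ht
  have e3 := (cayleyGraph_connected hgen).dist_triangle (u := P.γ P.n t) (v := P.γ P.n i)
    (w := P.γ k u)
  rw [SimpleGraph.dist_comm (u := P.γ P.n t) (v := P.γ P.n i)] at e3
  simp only [← wordDist_eq_dist hgen] at e3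
  rw [abs_of_nonpos (by omega)] at e1 e2
  have : wordDist A (P.γ P.n t) (P.γ k u) ≤ 2 * c := by omega
  exact_mod_cast this

end Forward

section Cuts

variable {V : Type*} {Γ : SimpleGraph V} {n : ℕ}

/-- The oriented edges of `Γ` leading from `C` to its complement. -/
def edgeCut (Γ : SimpleGraph V) (C : Set V) : Set (V × V) :=
  {p | Γ.Adj p.1 p.2 ∧ p.1 ∈ C ∧ p.2 ∉ C}

/-- A set of vertices is connected if it has no proper nonempty part closed under adjacency. -/
def ConnectedSet (Γ : SimpleGraph V) (C : Set V) : Prop :=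
  ∀ P ⊆ C, P.Nonempty → (∀ p ∈ P, ∀ q ∈ C, Γ.Adj p q → q ∈ P) → P = C

/-- The tight cuts of size at most `n`. -/
def tightCuts (Γ : SimpleGraph V) (n : ℕ) : Set (Set V) :=
  {C | ConnectedSet Γ C ∧ ConnectedSet Γ Cᶜ ∧ (edgeCut Γ C).encard ≤ n}

theorem ConnectedSet.exists_walk {C : Set V} (hC : ConnectedSet Γ C) {x y : V} (hx : x ∈ C)
    (hy : y ∈ C) : ∃ w : Γ.Walk x y, ∀ p ∈ w.support, p ∈ C := by
  have h := hC {q | q ∈ C ∧ ∃ w : Γ.Walk x q, ∀ p ∈ w.support, p ∈ C} (fun q hq => hq.1)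
    ⟨x, hx, SimpleGraph.Walk.nil, by simpa using hx⟩ (by
      rintro p ⟨hp, w, hw⟩ q hq hpq
      refine ⟨hq, w.concat hpq, ?_⟩
      intro z hz
      rw [SimpleGraph.Walk.support_concat] at hz
      simp only [List.mem_append, List.mem_singleton] at hz
      rcases hz with hz | rfl
      · exact hw z hz
      · exact hq)
  rw [← h] at hy
  exact hy.2

theorem ConnectedSet.exists_adj {C : Set V} (hC : ConnectedSet Γ C) {B : Set V}
    (h1 : (C ∩ B).Nonempty) (h2 : (C ∩ Bᶜ).Nonempty) :
    ∃ p ∈ C ∩ B, ∃ q ∈ C ∩ Bᶜ, Γ.Adj p q := by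
  by_contra! hcon
  have h := hC (C ∩ B) Set.inter_subset_left h1 (by
    intro p hp q hq hpq
    by_contra hq'
    exact hcon p hp q ⟨hq, fun h => hq' ⟨hq, h⟩⟩ hpq)
  obtain ⟨z, hz, hz'⟩ := h2
  rw [← h] at hz
  exact hz' hz.2

theorem edgeCut_compl (C : Set V) : edgeCut Γ Cᶜ = Prod.swap '' edgeCut Γ C := by
  ext ⟨p, q⟩
  simp [edgeCut, Γ.adj_comm p q]
  tauto

theorem finite_edgeCut_compl {C : Set V} (h : (edgeCut Γ C).Finite) : (edgeCut Γ Cᶜ).Finite := by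
  rw [edgeCut_compl]
  exact h.image _

theorem ncard_edgeCut_compl (C : Set V) : (edgeCut Γ Cᶜ).ncard = (edgeCut Γ C).ncard := by
  rw [edgeCut_compl, Set.ncard_image_of_injective _ Prod.swap_injective]

theorem edgeCut_inter_subset (A B : Set V) :
    edgeCut Γ (A ∩ B) ⊆ edgeCut Γ A ∪ edgeCut Γ B := by
  rintro p ⟨h1, ⟨h2, h3⟩, h4⟩
  by_cases h : p.2 ∈ A
  · exact Or.inr ⟨h1, h3, fun h' => h4 ⟨h, h'⟩⟩
  · exact Or.inl ⟨h1, h2, h⟩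

theorem edgeCut_union_subset (A B : Set V) :
    edgeCut Γ (A ∪ B) ⊆ edgeCut Γ A ∪ edgeCut Γ B := by
  rintro p ⟨h1, h2 | h2, h4⟩
  · exact Or.inl ⟨h1, h2, fun h' => h4 (Or.inl h')⟩
  · exact Or.inr ⟨h1, h2, fun h' => h4 (Or.inr h')⟩

theorem edgeCut_inter_inter_edgeCut_union_subset (A B : Set V) :
    edgeCut Γ (A ∩ B) ∩ edgeCut Γ (A ∪ B) ⊆ edgeCut Γ A ∩ edgeCut Γ B := by
  rintro p ⟨⟨h1, h2, h3⟩, _, h5, h6⟩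
  exact ⟨⟨h1, h2.1, fun h => h6 (Or.inl h)⟩, ⟨h1, h2.2, fun h => h6 (Or.inr h)⟩⟩

theorem ncard_add_ncard_le_of_subset {α : Type*} {a b s t : Set α} (hs : s.Finite) (ht : t.Finite)
    (h1 : a ∪ b ⊆ s ∪ t) (h2 : a ∩ b ⊆ s ∩ t) : a.ncard + b.ncard ≤ s.ncard + t.ncard := by
  have hab := (hs.union ht).subset h1
  rw [← Set.ncard_union_add_ncard_inter a b (hab.subset Set.subset_union_left)
    (hab.subset Set.subset_union_right), ← Set.ncard_union_add_ncard_inter s t hs ht]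
  exact add_le_add (Set.ncard_le_ncard h1 (hs.union ht))
    (Set.ncard_le_ncard h2 (hs.inter_of_left t))

theorem ncard_add_ncard_lt_of_subset {α : Type*} {a b s t : Set α} (hs : s.Finite) (ht : t.Finite)
    (h1 : a ∪ b ⊂ s ∪ t) (h2 : a ∩ b ⊆ s ∩ t) : a.ncard + b.ncard < s.ncard + t.ncard := by
  have hab := (hs.union ht).subset h1.subset
  rw [← Set.ncard_union_add_ncard_inter a b (hab.subset Set.subset_union_left)
    (hab.subset Set.subset_union_right), ← Set.ncard_union_add_ncard_inter s t hs ht]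
  exact add_lt_add_of_lt_of_le (Set.ncard_lt_ncard h1 (hs.union ht))
    (Set.ncard_le_ncard h2 (hs.inter_of_left t))

theorem finite_tightCuts_separating (n : ℕ) (Γ : SimpleGraph V) (x y : V) :
    {C | C ∈ tightCuts Γ n ∧ x ∈ C ∧ y ∉ C}.Finite := by
  have sub : ∀ C x, ConnectedSet Γ C → x ∈ C → ∀ z ∈ C, Γ.Reachable x z :=
    fun C x hC hx z hz => ⟨(hC.exists_walk hx hz).choose⟩
  induction n generalizing Γ x y with
  | zero =>
    by_cases hr : Γ.Reachable x y
    · obtain ⟨w⟩ := hr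
      convert Set.finite_empty
      refine Set.eq_empty_of_forall_notMem ?_
      rintro C ⟨⟨_, _, h0⟩, hx, hy⟩
      obtain ⟨d, _, h1, h2⟩ := w.exists_boundary_dart C hx hy
      have : edgeCut Γ C = ∅ := by simpa using h0
      exact this.subset (show (d.fst, d.snd) ∈ edgeCut Γ C from ⟨d.adj, h1, h2⟩)
    · refine (Set.finite_singleton {z | Γ.Reachable x z}).subset ?_
      rintro C ⟨⟨hC, hC', _⟩, hx, hy⟩
      refine Set.Subset.antisymm (fun z hz => sub C x hC hx z hz) fun z hz => ?_
      by_contra hz'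
      exact hr (hz.trans (sub Cᶜ y hC' hy z hz').symm)
  | succ n ih =>
    by_cases hr : Γ.Reachable x y
    · obtain ⟨w⟩ := hr
      refine Set.Finite.subset (Set.Finite.biUnion (List.finite_toSet w.darts)
        (t := fun d => {C | C ∈ tightCuts (Γ.deleteEdges {s(d.fst, d.snd)}) n ∧
          d.fst ∈ C ∧ d.snd ∉ C}) fun d _ => ih _ _ _ fun C x hC hx z hz =>
            ⟨(hC.exists_walk hx hz).choose⟩) ?_
      rintro C ⟨⟨hC, hC', h0⟩, hx, hy⟩
      obtain ⟨d, hd, h1, h2⟩ := w.exists_boundary_dart C hx hy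
      refine Set.mem_biUnion hd ⟨⟨?_, ?_, ?_⟩, h1, h2⟩
      · intro P hP hne hcl
        refine hC P hP hne fun p hp q hq hpq => hcl p hp q hq ?_
        rw [SimpleGraph.deleteEdges_adj]
        refine ⟨hpq, ?_⟩
        rw [Set.mem_singleton_iff, Sym2.eq_iff]
        rintro (⟨rfl, rfl⟩ | ⟨rfl, rfl⟩)
        · exact h2 hq
        · exact h2 (hP hp)
      · intro P hP hne hcl
        refine hC' P hP hne fun p hp q hq hpq => hcl p hp q hq ?_
        rw [SimpleGraph.deleteEdges_adj]
        refine ⟨hpq, ?_⟩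
        rw [Set.mem_singleton_iff, Sym2.eq_iff]
        rintro (⟨rfl, rfl⟩ | ⟨rfl, rfl⟩)
        · exact hP hp h1
        · exact hq h1
      · have hmem : (d.fst, d.snd) ∈ edgeCut Γ C := ⟨d.adj, h1, h2⟩
        have hsub : edgeCut (Γ.deleteEdges {s(d.fst, d.snd)}) C ⊆
            edgeCut Γ C \ {(d.fst, d.snd)} := by
          rintro ⟨p, q⟩ ⟨h3, h4, h5⟩
          rw [SimpleGraph.deleteEdges_adj] at h3
          refine ⟨⟨h3.1, h4, h5⟩, ?_⟩
          rintro h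
          obtain ⟨rfl, rfl⟩ := Prod.ext_iff.1 h
          exact h3.2 rfl
        refine (Set.encard_le_encard hsub).trans ?_
        have h6 := Set.encard_sdiff_singleton_add_one hmem
        rw [← h6] at h0
        push_cast at h0
        exact (ENat.add_le_add_iff_right (by simp)).1 h0
    · refine (Set.finite_singleton {z | Γ.Reachable x z}).subset ?_
      rintro C ⟨⟨hC, hC', _⟩, hx, hy⟩
      refine Set.Subset.antisymm (fun z hz => sub C x hC hx z hz) fun z hz => ?_
      by_contra hz'
      exact hr (hz.trans (sub Cᶜ y hC' hy z hz').symm)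

/-- Two sets cross if all four corners are nonempty. -/
def Cross (D C : Set V) : Prop :=
  (D ∩ C).Nonempty ∧ (D ∩ Cᶜ).Nonempty ∧ (Dᶜ ∩ C).Nonempty ∧ (Dᶜ ∩ Cᶜ).Nonempty

theorem cross_compl_right {D C : Set V} : Cross D Cᶜ ↔ Cross D C := by
  simp only [Cross, compl_compl]
  tauto

theorem cross_compl_left {D C : Set V} : Cross Dᶜ C ↔ Cross D C := by
  simp only [Cross, compl_compl]
  tauto

/-- The tight cuts of size at most `n` crossing `C`. -/
def crossing (Γ : SimpleGraph V) (n : ℕ) (C : Set V) : Set (Set V) :=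
  {D | D ∈ tightCuts Γ n ∧ Cross D C}

theorem crossing_compl (C : Set V) : crossing Γ n Cᶜ = crossing Γ n C := by
  ext D
  simp [crossing, cross_compl_right]

theorem finite_crossing {C : Set V} (hC : (edgeCut Γ C).Finite) : (crossing Γ n C).Finite := by
  refine Set.Finite.subset (hC.biUnion fun e _ => hC.biUnion fun e' _ =>
    finite_tightCuts_separating n Γ e.1 e'.1) ?_
  rintro D ⟨⟨hD, hD', hn⟩, h1, h2, h3, h4⟩
  obtain ⟨p, hp, q, hq, hpq⟩ := hD.exists_adj h1 h2
  obtain ⟨p', hp', q', hq', hpq'⟩ := hD'.exists_adj h3 h4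
  exact Set.mem_biUnion (show (p, q) ∈ edgeCut Γ C from ⟨hpq, hp.2, hq.2⟩)
    (Set.mem_biUnion (show (p', q') ∈ edgeCut Γ C from ⟨hpq', hp'.2, hq'.2⟩)
      ⟨⟨hD, hD', hn⟩, hp.1, hp'.1⟩)

theorem crossing_inter_subset {A B : Set V} (h : Cross A B) :
    crossing Γ n (A ∩ B) ⊆ crossing Γ n A ∪ crossing Γ n B := by
  rintro D ⟨hD, ⟨p, hp1, hp2, hp3⟩, ⟨q, hq1, hq2⟩, ⟨r, hr1, hr2, hr3⟩, ⟨s, hs1, hs2⟩⟩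
  obtain ⟨t, ht1, ht2⟩ := h.2.2.2
  by_contra hcon
  simp only [crossing, Set.mem_union, Set.mem_ofPred_eq, hD, true_and, not_or, Cross, not_and] at hcon
  obtain ⟨hA, hB⟩ := hcon
  have hA' : (D ∩ Aᶜ).Nonempty → ¬ (Dᶜ ∩ Aᶜ).Nonempty :=
    fun h => hA ⟨p, hp1, hp2⟩ h ⟨r, hr1, hr2⟩
  have hB' : (D ∩ Bᶜ).Nonempty → ¬ (Dᶜ ∩ Bᶜ).Nonempty :=
    fun h => hB ⟨p, hp1, hp3⟩ h ⟨r, hr1, hr3⟩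
  rw [Set.compl_inter] at hq2 hs2
  by_cases htD : t ∈ D
  · rcases hs2 with hs2 | hs2
    · exact hA' ⟨t, htD, ht1⟩ ⟨s, hs1, hs2⟩
    · exact hB' ⟨t, htD, ht2⟩ ⟨s, hs1, hs2⟩
  · rcases hq2 with hq2 | hq2
    · exact hA' ⟨q, hq1, hq2⟩ ⟨t, htD, ht1⟩
    · exact hB' ⟨q, hq1, hq2⟩ ⟨t, htD, ht2⟩

theorem crossing_union_subset {A B : Set V} (h : Cross A B) :
    crossing Γ n (A ∪ B) ⊆ crossing Γ n A ∪ crossing Γ n B := by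
  have := crossing_inter_subset (Γ := Γ) (n := n) (A := Aᶜ) (B := Bᶜ)
    (cross_compl_left.2 (cross_compl_right.2 h))
  rwa [← Set.compl_union, crossing_compl, crossing_compl, crossing_compl] at this

theorem crossing_inter_inter_crossing_union_subset (A B : Set V) :
    crossing Γ n (A ∩ B) ∩ crossing Γ n (A ∪ B) ⊆ crossing Γ n A ∩ crossing Γ n B := by
  rintro D ⟨⟨hD, ⟨p, hp1, hp2, hp3⟩, -, ⟨r, hr1, hr2, hr3⟩, -⟩,
    ⟨-, -, ⟨q, hq1, hq2⟩, -, ⟨s, hs1, hs2⟩⟩⟩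
  rw [Set.compl_union] at hq2 hs2
  exact ⟨⟨hD, ⟨p, hp1, hp2⟩, ⟨q, hq1, hq2.1⟩, ⟨r, hr1, hr2⟩, ⟨s, hs1, hs2.1⟩⟩,
    ⟨hD, ⟨p, hp1, hp3⟩, ⟨q, hq1, hq2.2⟩, ⟨r, hr1, hr3⟩, ⟨s, hs1, hs2.2⟩⟩⟩

theorem ncard_crossing_lt {A B : Set V} (hA : (edgeCut Γ A).Finite) (hB : (edgeCut Γ B).Finite)
    (hAt : A ∈ tightCuts Γ n) (h : Cross A B) :
    (crossing Γ n (A ∩ B)).ncard + (crossing Γ n (A ∪ B)).ncard <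
      (crossing Γ n A).ncard + (crossing Γ n B).ncard := by
  refine ncard_add_ncard_lt_of_subset (finite_crossing hA) (finite_crossing hB) ?_
    (crossing_inter_inter_crossing_union_subset A B)
  refine ⟨Set.union_subset (crossing_inter_subset h) (crossing_union_subset h), fun hsub => ?_⟩
  rcases hsub (Or.inr ⟨hAt, h⟩ : A ∈ crossing Γ n A ∪ crossing Γ n B) with h' | h'
  · obtain ⟨z, hz1, hz2, _⟩ := h'.2.2.2.1
    exact hz1 hz2
  · obtain ⟨z, hz1, hz2⟩ := h'.2.2.1
    exact hz2 (Or.inl hz1)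

/-- The complexity of a cut: its size, then the number of tight cuts it crosses. -/
noncomputable def complexity (Γ : SimpleGraph V) (n : ℕ) (C : Set V) : ℕ ×ₗ ℕ :=
  toLex ((edgeCut Γ C).ncard, (crossing Γ n C).ncard)

theorem complexity_compl (C : Set V) : complexity Γ n Cᶜ = complexity Γ n C := by
  rw [complexity, complexity, ncard_edgeCut_compl, crossing_compl]

theorem complexity_corner {A B : Set V} (hA : (edgeCut Γ A).Finite) (hB : (edgeCut Γ B).Finite)
    (hAt : A ∈ tightCuts Γ n) (h : Cross A B) :
    ¬ (complexity Γ n A ≤ complexity Γ n (A ∩ B) ∧ complexity Γ n B ≤ complexity Γ n (A ∪ B)) ∧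
    ¬ (complexity Γ n B ≤ complexity Γ n (A ∩ B) ∧ complexity Γ n A ≤ complexity Γ n (A ∪ B)) := by
  have h1 := ncard_crossing_lt hA hB hAt h
  have h2 := ncard_add_ncard_le_of_subset hA hB
    (Set.union_subset (edgeCut_inter_subset A B) (edgeCut_union_subset A B))
    (edgeCut_inter_inter_edgeCut_union_subset A B)
  simp only [complexity, Prod.Lex.toLex_le_toLex]
  omega

/-- The cuts of size at most `n` that separate some two ultrafilters with least complexity. -/
def optimalCuts (Γ : SimpleGraph V) (n : ℕ) : Set (Set V) :=
  {C | (edgeCut Γ C).Finite ∧ (edgeCut Γ C).ncard ≤ n ∧ ∃ U W : Ultrafilter V, C ∈ U ∧ C ∉ W ∧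
    ∀ D, (edgeCut Γ D).Finite → D ∈ U → D ∉ W → complexity Γ n C ≤ complexity Γ n D}

theorem compl_mem_optimalCuts {C : Set V} (h : C ∈ optimalCuts Γ n) : Cᶜ ∈ optimalCuts Γ n := by
  obtain ⟨h1, h2, U, W, h3, h4, h5⟩ := h
  refine ⟨finite_edgeCut_compl h1, by rwa [ncard_edgeCut_compl], W, U,
    Ultrafilter.compl_mem_iff_notMem.2 h4, fun h => Ultrafilter.compl_mem_iff_notMem.1 h h3,
    fun D hD hDW hDU => ?_⟩
  rw [complexity_compl, ← complexity_compl D]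
  exact h5 _ (finite_edgeCut_compl hD) (Ultrafilter.compl_mem_iff_notMem.2 hDU)
    fun h => Ultrafilter.compl_mem_iff_notMem.1 h hDW

theorem exists_mem_optimalCuts {D : Set V} (hD : (edgeCut Γ D).Finite)
    (hn : (edgeCut Γ D).ncard ≤ n) {U W : Ultrafilter V} (hU : D ∈ U) (hW : D ∉ W) :
    ∃ C ∈ optimalCuts Γ n, C ∈ U ∧ C ∉ W := by
  obtain ⟨C, ⟨hC, hCU, hCW⟩, hmin⟩ := exists_minimalFor_of_wellFoundedLT
    (fun D => (edgeCut Γ D).Finite ∧ D ∈ U ∧ D ∉ W) (complexity Γ n) ⟨D, hD, hU, hW⟩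
  have hmin' : ∀ D, (edgeCut Γ D).Finite → D ∈ U → D ∉ W →
      complexity Γ n C ≤ complexity Γ n D := fun D h1 h2 h3 => by
    rcases le_total (complexity Γ n C) (complexity Γ n D) with h | h
    · exact h
    · exact hmin ⟨h1, h2, h3⟩ h
  refine ⟨C, ⟨hC, ?_, U, W, hCU, hCW, hmin'⟩, hCU, hCW⟩
  have := hmin' D hD hU hW
  simp only [complexity, Prod.Lex.toLex_le_toLex] at this
  omega

theorem nonempty_of_mem_optimalCuts {C : Set V} (h : C ∈ optimalCuts Γ n) : C.Nonempty := by
  obtain ⟨_, _, U, W, h3, h4, h5⟩ := h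
  exact U.nonempty_of_mem h3

theorem edgeCut_nonempty (hΓ : Γ.Connected) {C : Set V} (h1 : C.Nonempty) (h2 : Cᶜ.Nonempty) :
    (edgeCut Γ C).Nonempty := by
  obtain ⟨x, hx⟩ := h1
  obtain ⟨y, hy⟩ := h2
  obtain ⟨w⟩ := hΓ.preconnected x y
  obtain ⟨d, _, h1, h2⟩ := w.exists_boundary_dart C hx hy
  exact ⟨(d.fst, d.snd), d.adj, h1, h2⟩

theorem connectedSet_of_mem_optimalCuts (hΓ : Γ.Connected) {C : Set V}
    (h : C ∈ optimalCuts Γ n) : ConnectedSet Γ C := by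
  have hne := nonempty_of_mem_optimalCuts (compl_mem_optimalCuts h)
  obtain ⟨hfin, _, U, W, hU, hW, hmin⟩ := h
  have key : ∀ P ⊆ C, (C \ P).Nonempty → (∀ p ∈ P, ∀ q ∈ C, Γ.Adj p q → q ∈ P) → P ∉ U := by
    intro P hP hne' hcl hPU
    have hsub : edgeCut Γ P ⊆ edgeCut Γ C := by
      rintro ⟨p, q⟩ ⟨h1, h2, h3⟩
      exact ⟨h1, hP h2, fun hq => h3 (hcl p h2 q hq h1)⟩
    have hssub : edgeCut Γ P ⊂ edgeCut Γ C := by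
      obtain ⟨⟨p, q⟩, h1, h2, h3⟩ := edgeCut_nonempty hΓ hne' (by
        obtain ⟨z, hz⟩ := hne
        exact ⟨z, fun h => hz h.1⟩)
      refine ⟨hsub, fun hsub' => h2.2 (hsub' (a := (p, q)) ⟨h1, h2.1, fun hq => ?_⟩).2.1⟩
      have hqP : q ∈ P := by
        by_contra hqP
        exact h3 ⟨hq, hqP⟩
      exact h2.2 (hcl q hqP p h2.1 h1.symm)
    have := hmin P (hfin.subset hsub) hPU fun h => hW (W.mem_of_superset h hP)
    have hlt := Set.ncard_lt_ncard hssub hfin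
    simp only [complexity, Prod.Lex.toLex_le_toLex] at this
    omega
  intro P hP hPne hcl
  by_contra hPC
  have hdiff : (C \ P).Nonempty := Set.sdiff_nonempty.2 fun h => hPC (hP.antisymm h)
  have h1 := key P hP hdiff hcl
  have h2 := key (C \ P) Set.sdiff_subset (by rwa [Set.sdiff_sdiff_cancel_left hP]) (by
    rintro p ⟨hp, hp'⟩ q hq hpq
    exact ⟨hq, fun hqP => hp' (hcl q hqP p hp hpq.symm)⟩)
  rw [← Set.union_sdiff_cancel hP, Ultrafilter.union_mem_iff] at hU
  tauto

theorem optimalCuts_subset_tightCuts (hΓ : Γ.Connected) : optimalCuts Γ n ⊆ tightCuts Γ n :=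
  fun C hC => ⟨connectedSet_of_mem_optimalCuts hΓ hC,
    connectedSet_of_mem_optimalCuts hΓ (compl_mem_optimalCuts hC), by
      rw [← hC.1.cast_ncard_eq]
      exact_mod_cast hC.2.1⟩

theorem not_corners_le {α : Type*} [LinearOrder α] {a b k₁ k₂ k₃ k₄ : α}
    (c₁ : ¬ (a ≤ k₁ ∧ b ≤ k₄) ∧ ¬ (b ≤ k₁ ∧ a ≤ k₄))
    (c₂ : ¬ (a ≤ k₂ ∧ b ≤ k₃) ∧ ¬ (b ≤ k₂ ∧ a ≤ k₃))
    (a₁ : a ≤ k₁ ∨ a ≤ k₂) (a₂ : a ≤ k₃ ∨ a ≤ k₄)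
    (b₁ : b ≤ k₁ ∨ b ≤ k₃) (b₂ : b ≤ k₂ ∨ b ≤ k₄) : False := by
  grind

theorem not_cross_of_mem_optimalCuts (hΓ : Γ.Connected) {A B : Set V} (hA : A ∈ optimalCuts Γ n)
    (hB : B ∈ optimalCuts Γ n) : ¬ Cross A B := by
  intro h
  have hAt := optimalCuts_subset_tightCuts hΓ hA
  obtain ⟨fA, _, U, W, hU, hW, hmin⟩ := hA
  obtain ⟨fB, _, U', W', hU', hW', hmin'⟩ := hB
  have fA' := finite_edgeCut_compl fA
  have fB' := finite_edgeCut_compl fB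
  have fin : ∀ {X Y : Set V}, (edgeCut Γ X).Finite → (edgeCut Γ Y).Finite →
      (edgeCut Γ (X ∩ Y)).Finite := fun hX hY => (hX.union hY).subset (edgeCut_inter_subset _ _)
  have c1 := complexity_corner fA fB hAt h
  have c2 := complexity_corner fA fB' hAt (cross_compl_right.2 h)
  have e1 : complexity Γ n (A ∪ B) = complexity Γ n (Aᶜ ∩ Bᶜ) := by
    rw [← complexity_compl, Set.compl_union]
  have e2 : complexity Γ n (A ∪ Bᶜ) = complexity Γ n (Aᶜ ∩ B) := by
    rw [← complexity_compl, Set.compl_union, compl_compl]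
  rw [e1] at c1
  rw [e2, complexity_compl] at c2
  have neg : ∀ {X : Set V}, (edgeCut Γ X).Finite → X ∈ W → X ∉ U →
      complexity Γ n A ≤ complexity Γ n X := fun {X} hX h1 h2 => by
    rw [← complexity_compl X]
    exact hmin _ (finite_edgeCut_compl hX) (Ultrafilter.compl_mem_iff_notMem.2 h2)
      fun h => Ultrafilter.compl_mem_iff_notMem.1 h h1
  have neg' : ∀ {X : Set V}, (edgeCut Γ X).Finite → X ∈ W' → X ∉ U' →
      complexity Γ n B ≤ complexity Γ n X := fun {X} hX h1 h2 => by
    rw [← complexity_compl X]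
    exact hmin' _ (finite_edgeCut_compl hX) (Ultrafilter.compl_mem_iff_notMem.2 h2)
      fun h => Ultrafilter.compl_mem_iff_notMem.1 h h1
  have hcW : Aᶜ ∈ W := Ultrafilter.compl_mem_iff_notMem.2 hW
  have hcW' : Bᶜ ∈ W' := Ultrafilter.compl_mem_iff_notMem.2 hW'
  have hcU : Aᶜ ∉ U := fun h => Ultrafilter.compl_mem_iff_notMem.1 h hU
  have hcU' : Bᶜ ∉ U' := fun h => Ultrafilter.compl_mem_iff_notMem.1 h hU'
  have a12 : complexity Γ n A ≤ complexity Γ n (A ∩ B) ∨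
      complexity Γ n A ≤ complexity Γ n (A ∩ Bᶜ) := by
    rcases U.mem_or_compl_mem B with hb | hb
    · exact Or.inl (hmin _ (fin fA fB) (Filter.inter_mem hU hb)
        fun h => hW (W.mem_of_superset h Set.inter_subset_left))
    · exact Or.inr (hmin _ (fin fA fB') (Filter.inter_mem hU hb)
        fun h => hW (W.mem_of_superset h Set.inter_subset_left))
  have a34 : complexity Γ n A ≤ complexity Γ n (Aᶜ ∩ B) ∨
      complexity Γ n A ≤ complexity Γ n (Aᶜ ∩ Bᶜ) := by
    rcases W.mem_or_compl_mem B with hb | hb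
    · exact Or.inl (neg (fin fA' fB) (Filter.inter_mem hcW hb)
        fun h => hcU (U.mem_of_superset h Set.inter_subset_left))
    · exact Or.inr (neg (fin fA' fB') (Filter.inter_mem hcW hb)
        fun h => hcU (U.mem_of_superset h Set.inter_subset_left))
  have b13 : complexity Γ n B ≤ complexity Γ n (A ∩ B) ∨
      complexity Γ n B ≤ complexity Γ n (Aᶜ ∩ B) := by
    rcases U'.mem_or_compl_mem A with hb | hb
    · exact Or.inl (hmin' _ (fin fA fB) (Filter.inter_mem hb hU')
        fun h => hW' (W'.mem_of_superset h Set.inter_subset_right))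
    · exact Or.inr (hmin' _ (fin fA' fB) (Filter.inter_mem hb hU')
        fun h => hW' (W'.mem_of_superset h Set.inter_subset_right))
  have b24 : complexity Γ n B ≤ complexity Γ n (A ∩ Bᶜ) ∨
      complexity Γ n B ≤ complexity Γ n (Aᶜ ∩ Bᶜ) := by
    rcases W'.mem_or_compl_mem A with hb | hb
    · exact Or.inl (neg' (fin fA fB') (Filter.inter_mem hb hcW')
        fun h => hcU' (U'.mem_of_superset h Set.inter_subset_right))
    · exact Or.inr (neg' (fin fA' fB') (Filter.inter_mem hb hcW')
        fun h => hcU' (U'.mem_of_superset h Set.inter_subset_right))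
  exact not_corners_le c1 c2 a12 a34 b13 b24

theorem finite_optimalCuts_separating (hΓ : Γ.Connected) (x y : V) :
    {C | C ∈ optimalCuts Γ n ∧ x ∈ C ∧ y ∉ C}.Finite :=
  (finite_tightCuts_separating n Γ x y).subset
    fun _ hC => ⟨optimalCuts_subset_tightCuts hΓ hC.1, hC.2⟩

theorem edgeCut_preimage {f : V ≃ V} (hf : ∀ x y, Γ.Adj (f x) (f y) ↔ Γ.Adj x y) (C : Set V) :
    edgeCut Γ (f ⁻¹' C) = (f.prodCongr f) ⁻¹' edgeCut Γ C := by
  ext ⟨p, q⟩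
  simp [edgeCut, hf]

theorem preimage_equiv_eq_image {α : Type*} (f : α ≃ α) (s : Set α) : f ⁻¹' s = f.symm '' s :=
  (f.symm.image_eq_preimage_symm s).symm

theorem finite_edgeCut_preimage {f : V ≃ V} (hf : ∀ x y, Γ.Adj (f x) (f y) ↔ Γ.Adj x y)
    {C : Set V} (hC : (edgeCut Γ C).Finite) : (edgeCut Γ (f ⁻¹' C)).Finite := by
  rw [edgeCut_preimage hf]
  exact hC.preimage (f.prodCongr f).injective.injOn

theorem ncard_edgeCut_preimage {f : V ≃ V} (hf : ∀ x y, Γ.Adj (f x) (f y) ↔ Γ.Adj x y)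
    (C : Set V) : (edgeCut Γ (f ⁻¹' C)).ncard = (edgeCut Γ C).ncard := by
  rw [edgeCut_preimage hf, preimage_equiv_eq_image,
    Set.ncard_image_of_injective _ (Equiv.injective _)]

theorem ConnectedSet.preimage {f : V ≃ V} (hf : ∀ x y, Γ.Adj (f x) (f y) ↔ Γ.Adj x y)
    {C : Set V} (hC : ConnectedSet Γ C) : ConnectedSet Γ (f ⁻¹' C) := by
  intro P hP hne hcl
  have h := hC (f '' P) (Set.image_subset_iff.2 hP) (hne.image _) (by
    rintro _ ⟨p, hp, rfl⟩ q hq hpq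
    refine ⟨f.symm q, hcl p hp _ (by simpa using hq) ?_, by simp⟩
    rw [← hf, f.apply_symm_apply]
    exact hpq)
  rw [← h, Set.preimage_image_eq _ f.injective]

theorem preimage_mem_tightCuts {f : V ≃ V} (hf : ∀ x y, Γ.Adj (f x) (f y) ↔ Γ.Adj x y)
    {C : Set V} (hC : C ∈ tightCuts Γ n) : f ⁻¹' C ∈ tightCuts Γ n := by
  refine ⟨hC.1.preimage hf, by simpa using hC.2.1.preimage hf, ?_⟩
  rw [edgeCut_preimage hf, preimage_equiv_eq_image,
    Function.Injective.encard_image (Equiv.injective _)]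
  exact hC.2.2

theorem adj_symm_apply {f : V ≃ V} (hf : ∀ x y, Γ.Adj (f x) (f y) ↔ Γ.Adj x y) (x y : V) :
    Γ.Adj (f.symm x) (f.symm y) ↔ Γ.Adj x y := by
  rw [← hf, f.apply_symm_apply, f.apply_symm_apply]

theorem cross_preimage {f : V ≃ V} {D C : Set V} : Cross (f ⁻¹' D) (f ⁻¹' C) ↔ Cross D C := by
  simp only [Cross, ← Set.preimage_compl, ← Set.preimage_inter, f.surjective.nonempty_preimage]

theorem crossing_preimage {f : V ≃ V} (hf : ∀ x y, Γ.Adj (f x) (f y) ↔ Γ.Adj x y) (C : Set V) :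
    crossing Γ n (f ⁻¹' C) = (fun D => f ⁻¹' D) '' crossing Γ n C := by
  ext D
  have hD : f ⁻¹' (f.symm ⁻¹' D) = D := by simp [← Set.preimage_comp]
  constructor
  · rintro ⟨h1, h2⟩
    refine ⟨f.symm ⁻¹' D, ⟨preimage_mem_tightCuts (adj_symm_apply hf) h1, ?_⟩, hD⟩
    rw [← cross_preimage (f := f), hD]
    exact h2
  · rintro ⟨D, ⟨h1, h2⟩, rfl⟩
    exact ⟨preimage_mem_tightCuts hf h1, cross_preimage.2 h2⟩

theorem complexity_preimage {f : V ≃ V} (hf : ∀ x y, Γ.Adj (f x) (f y) ↔ Γ.Adj x y) (C : Set V) :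
    complexity Γ n (f ⁻¹' C) = complexity Γ n C := by
  rw [complexity, complexity, ncard_edgeCut_preimage hf, crossing_preimage hf,
    Set.ncard_image_of_injective _ f.surjective.preimage_injective]

theorem preimage_mem_optimalCuts {f : V ≃ V} (hf : ∀ x y, Γ.Adj (f x) (f y) ↔ Γ.Adj x y)
    {C : Set V} (hC : C ∈ optimalCuts Γ n) : f ⁻¹' C ∈ optimalCuts Γ n := by
  obtain ⟨h1, h2, U, W, h3, h4, h5⟩ := hC
  have hf' := adj_symm_apply hf
  have hmem : ∀ (D : Set V) (U : Ultrafilter V), D ∈ U.map f.symm ↔ f.symm ⁻¹' D ∈ U :=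
    fun D U => Iff.rfl
  refine ⟨finite_edgeCut_preimage hf h1, by rwa [ncard_edgeCut_preimage hf], U.map f.symm,
    W.map f.symm, ?_, ?_, fun D hD hDU hDW => ?_⟩
  · rw [hmem]
    simpa [← Set.preimage_comp] using h3
  · rw [hmem]
    simpa [← Set.preimage_comp] using h4
  · rw [complexity_preimage hf, ← complexity_preimage hf' D]
    exact h5 _ (finite_edgeCut_preimage hf' hD) hDU hDW

end Cuts

section Trees

universe u

/-- A rooted tree, given by its adjacency relation, height function and parent function. -/
structure RootedTree (V : Type u) where
  adj : V → V → Prop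
  root : V
  height : V → ℕ
  parent : V → V
  symm : ∀ {u v}, adj u v → adj v u
  eq_root_of_height : ∀ {v}, height v = 0 → v = root
  height_root : height root = 0
  adj_parent : ∀ {v}, v ≠ root → adj (parent v) v
  height_parent : ∀ {v}, v ≠ root → height v = height (parent v) + 1
  eq_parent_or : ∀ {u v}, adj u v → (v ≠ root ∧ u = parent v) ∨ (u ≠ root ∧ v = parent u)

namespace RootedTree

variable {V : Type u} (T : RootedTree V)

theorem even_height_iff {u v : V} (h : T.adj u v) : Even (T.height u) ↔ ¬ Even (T.height v) := by
  rcases T.eq_parent_or h with ⟨h1, rfl⟩ | ⟨h1, rfl⟩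
  · rw [T.height_parent h1, Nat.even_add_one, not_not]
  · rw [T.height_parent h1, Nat.even_add_one]

theorem induction {P : V → Prop} (h0 : P T.root) (h : ∀ v, v ≠ T.root → P (T.parent v) → P v)
    (v : V) : P v := by
  generalize hn : T.height v = n
  induction n generalizing v with
  | zero => exact T.eq_root_of_height hn ▸ h0
  | succ n ih =>
    have hv : v ≠ T.root := by
      rintro rfl
      rw [T.height_root] at hn
      omega
    have := T.height_parent hv
    exact h v hv (ih _ (by omega))

/-- A section over the vertices is flat if it is compatible with transport along edges. -/
def IsFlat {Z : Type*} (τ : V → V → Z → Z) (σ : V → Z) : Prop :=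
  ∀ u v, T.adj u v → σ v = τ u v (σ u)

theorem exists_isFlat {Z : Type*} (P : V → Z → Prop) (τ : V → V → Z → Z)
    (hτ : ∀ u v z, T.adj u v → P u z → P v (τ u v z) ∧ τ v u (τ u v z) = z) {z₀ : Z}
    (hz₀ : P T.root z₀) : ∃ σ : V → Z, σ T.root = z₀ ∧ (∀ v, P v (σ v)) ∧ T.IsFlat τ σ := by
  let s : ℕ → V → Z := fun n => n.rec (fun _ => z₀)
    (fun _ f v => τ (T.parent v) v (f (T.parent v)))
  let σ : V → Z := fun v => s (T.height v) v
  have h0 : σ T.root = z₀ := by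
    simp only [σ, T.height_root]
    rfl
  have hs : ∀ v, v ≠ T.root → σ v = τ (T.parent v) v (σ (T.parent v)) := by
    intro v hv
    simp only [σ, T.height_parent hv]
    rfl
  have hP : ∀ v, P v (σ v) := T.induction (by rwa [h0]) fun v hv ih => by
    rw [hs v hv]
    exact (hτ _ _ _ (T.adj_parent hv) ih).1
  refine ⟨σ, h0, hP, fun u v huv => ?_⟩
  rcases T.eq_parent_or huv with ⟨h1, rfl⟩ | ⟨h1, rfl⟩
  · exact hs v h1
  · conv_rhs => rw [hs u h1]
    exact (hτ _ _ _ (T.adj_parent h1) (hP _)).2.symm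

theorem IsFlat.eq_of_root {Z : Type*} {τ : V → V → Z → Z} {σ σ' : V → Z} (h : T.IsFlat τ σ)
    (h' : T.IsFlat τ σ') (h0 : σ T.root = σ' T.root) : σ = σ' := by
  funext v
  induction v using T.induction with
  | h0 => exact h0
  | h v hv ih => rw [h _ _ (T.adj_parent hv), h' _ _ (T.adj_parent hv), ih]

section FreeAction

variable {K : Type u} [Group K] [MulAction K V]

open Classical in
/-- The label of an edge, oriented from even to odd vertices. -/
noncomputable def letter (K : Type u) [Group K] [MulAction K V] (u v : V) :
    MulAction.orbitRel.Quotient K (V × V) × Bool :=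
  if Even (T.height u) then (Quotient.mk'' (u, v), true) else (Quotient.mk'' (v, u), false)

theorem letter_smul (heven : ∀ (k : K) v, Even (T.height (k • v)) ↔ Even (T.height v)) (k : K)
    (u v : V) : T.letter K (k • u) (k • v) = T.letter K u v := by
  have h : ∀ a b : V, (Quotient.mk'' (k • a, k • b) : MulAction.orbitRel.Quotient K (V × V)) =
      Quotient.mk'' (a, b) := fun a b => Quotient.sound' ⟨k, rfl⟩
  simp only [letter, heven, h]

theorem letter_swap {u v : V} (h : T.adj u v) :
    T.letter K v u = ((T.letter K u v).1, !(T.letter K u v).2) := by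
  have := T.even_height_iff h
  by_cases hu : Even (T.height u)
  · simp [letter, hu, this.1 hu]
  · have hv : Even (T.height v) := by tauto
    simp [letter, hu, hv]

theorem letter_snd_of_fst_eq (hfree : ∀ (k : K) (v : V), k • v = v → k = 1)
    {u v w : V} (huv : T.adj u v) (hne : u ≠ w) (h : (T.letter K u v).1 = (T.letter K v w).1) :
    (T.letter K u v).2 = (T.letter K v w).2 := by
  exfalso
  have key : ∀ a b : V, (Quotient.mk'' (a, v) : MulAction.orbitRel.Quotient K (V × V)) =
      Quotient.mk'' (b, v) → a = b := by
    intro a b hab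
    obtain ⟨k, hk⟩ := Quotient.exact' hab
    obtain ⟨h1, h2⟩ := Prod.ext_iff.1 hk
    have := hfree k v h2
    subst this
    simpa using h1.symm
  have key' : ∀ a b : V, (Quotient.mk'' (v, a) : MulAction.orbitRel.Quotient K (V × V)) =
      Quotient.mk'' (v, b) → a = b := by
    intro a b hab
    obtain ⟨k, hk⟩ := Quotient.exact' hab
    obtain ⟨h1, h2⟩ := Prod.ext_iff.1 hk
    have := hfree k v h1
    subst this
    simpa using h2.symm
  have h1 := T.even_height_iff huv
  by_cases hu : Even (T.height u)
  · simp only [letter, hu, h1.1 hu, if_true, if_false] at h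
    exact hne (key _ _ h)
  · have hv : Even (T.height v) := by tauto
    simp only [letter, hu, hv, if_true, if_false] at h
    exact hne (key' _ _ h)

/-- A group acting freely on a rooted tree (not necessarily fixing the root), preserving the parity
of the height, is free. -/
theorem isFreeGroup_of_free_action (hadj : ∀ (k : K) u v, T.adj u v → T.adj (k • u) (k • v))
    (heven : ∀ (k : K) v, Even (T.height (k • v)) ↔ Even (T.height v))
    (hfree : ∀ (k : K) (v : V), k • v = v → k = 1) : IsFreeGroup K := by
  obtain ⟨σ, h0, -, hσ⟩ := T.exists_isFlat (fun _ _ => True)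
    (fun u v z => z * FreeGroup.mk [T.letter K u v]) (by
      intro u v z huv _
      refine ⟨trivial, ?_⟩
      rw [mul_assoc, T.letter_swap huv, mul_eq_left, mul_eq_one_iff_inv_eq, FreeGroup.inv_mk]
      rfl) (z₀ := 1) trivial
  have hmul : ∀ (k : K) v, σ (k • v) = σ (k • T.root) * σ v := by
    intro k v
    refine congrFun (IsFlat.eq_of_root T (τ := fun u v z => z * FreeGroup.mk [T.letter K u v])
      (σ := fun v => σ (k • v)) (σ' := fun v => σ (k • T.root) * σ v) ?_ ?_ (by simp [h0])) v
    · intro u v huv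
      refine (hσ _ _ (hadj k u v huv)).trans ?_
      simp only [T.letter_smul heven]
    · intro u v huv
      refine (congrArg _ (hσ _ _ huv)).trans ?_
      simp only [mul_assoc]
  let φ : K →* FreeGroup (MulAction.orbitRel.Quotient K (V × V)) :=
    { toFun := fun k => σ (k • T.root)
      map_one' := by rw [one_smul, h0]
      map_mul' := fun k l => by rw [mul_smul, hmul] }
  have hword : ∀ v, ∃ L, FreeGroup.IsReduced L ∧ FreeGroup.mk L = σ v ∧ L.length = T.height v ∧
      (v ≠ T.root → L.getLast? = some (T.letter K (T.parent v) v)) := by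
    intro v
    induction v using T.induction with
    | h0 => exact ⟨[], by simp [FreeGroup.IsReduced], by rw [h0]; rfl, by simp [T.height_root],
        fun h => absurd rfl h⟩
    | h v hv ih =>
      obtain ⟨L, hL, hLσ, hlen, hlast⟩ := ih
      refine ⟨L ++ [T.letter K (T.parent v) v], ?_, ?_, by simp [hlen, T.height_parent hv],
        by simp⟩
      · rw [FreeGroup.IsReduced, List.isChain_append]
        refine ⟨hL, List.isChain_singleton _, ?_⟩
        intro x hx y hy
        simp only [List.head?_cons, Option.mem_def, Option.some.injEq] at hy
        subst hy
        by_cases hp : T.parent v = T.root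
        · rw [List.length_eq_zero_iff.1 (hlen.trans (by rw [hp, T.height_root]))] at hx
          simp at hx
        · rw [hlast hp] at hx
          simp only [Option.mem_def, Option.some.injEq] at hx
          subst hx
          refine T.letter_snd_of_fst_eq hfree (T.adj_parent hp) ?_
          intro h
          have h1 := T.height_parent hp
          have h2 := T.height_parent hv
          rw [h] at h1
          omega
      · rw [← FreeGroup.mul_mk, hLσ, hσ _ _ (T.adj_parent hv)]
  have hinj : Function.Injective φ := by
    rw [injective_iff_map_eq_one]
    intro k hk
    classical
    obtain ⟨L, hL, hLσ, hlen, -⟩ := hword (k • T.root)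
    rw [show σ (k • T.root) = 1 from hk] at hLσ
    have : L = [] := by
      rw [← hL.reduce_eq, ← FreeGroup.toWord_mk, hLσ, FreeGroup.toWord_one]
    rw [this] at hlen
    exact hfree k _ (T.eq_root_of_height hlen.symm)
  exact IsFreeGroup.ofMulEquiv (MonoidHom.ofInjective hinj).symm

end FreeAction

/-- For an equivariant transport with a finite fibre over the root, a subgroup of finite index
preserves all flat sections. -/
theorem exists_finiteIndex_forall_isFlat {G : Type*} [Group G] [MulAction G V]
    (hadj : ∀ (g : G) u v, T.adj u v → T.adj (g • u) (g • v)) {Z : Type*} [MulAction G Z]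
    (E : V → Set Z) (hE : (E T.root).Finite) (hEg : ∀ (g : G) v z, z ∈ E v → g • z ∈ E (g • v))
    (τ : V → V → Z → Z)
    (hτ : ∀ (g : G) u v z, T.adj u v → z ∈ E u → τ (g • u) (g • v) (g • z) = g • τ u v z) :
    ∃ K : Subgroup G, K.FiniteIndex ∧ ∀ k ∈ K, ∀ σ : V → Z, (∀ v, σ v ∈ E v) → T.IsFlat τ σ →
      ∀ v, σ (k • v) = k • σ v := by
  let X := {σ : V → Z // (∀ v, σ v ∈ E v) ∧ T.IsFlat τ σ}
  let act : G → X → X := fun g σ => ⟨fun v => g • σ.1 (g⁻¹ • v), fun v => by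
      simpa using hEg g _ _ (σ.2.1 (g⁻¹ • v)), fun u v huv => by
      have h1 := hadj g⁻¹ _ _ huv
      have h2 := hτ g _ _ _ h1 (σ.2.1 (g⁻¹ • u))
      rw [smul_inv_smul, smul_inv_smul] at h2
      simp only
      rw [h2, ← σ.2.2 _ _ h1]⟩
  let _ : MulAction G X :=
    { smul := act
      one_smul := fun σ => Subtype.ext (funext fun v => by
        show (1 : G) • σ.1 ((1 : G)⁻¹ • v) = σ.1 v
        simp)
      mul_smul := fun g h σ => Subtype.ext (funext fun v => by
        show (g * h) • σ.1 ((g * h)⁻¹ • v) = g • h • σ.1 (h⁻¹ • g⁻¹ • v)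
        simp [mul_smul]) }
  have : Finite X := by
    have := hE.to_subtype
    refine Finite.of_injective (fun σ : X => (⟨σ.1 T.root, σ.2.1 _⟩ : E T.root)) ?_
    intro σ σ' h
    exact Subtype.ext (IsFlat.eq_of_root T σ.2.2 σ'.2.2 (congrArg Subtype.val h))
  refine ⟨(MulAction.toPermHom G X).ker, inferInstance, fun k hk σ h1 h2 v => ?_⟩
  have h3 : k • (⟨σ, h1, h2⟩ : X) = ⟨σ, h1, h2⟩ := by
    have := congrArg (fun e : Equiv.Perm X => e ⟨σ, h1, h2⟩) (MonoidHom.mem_ker.1 hk)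
    simpa using this
  have h4 := congrFun (congrArg Subtype.val h3) (k • v)
  refine h4.symm.trans ?_
  show k • σ (k⁻¹ • k • v) = _
  rw [inv_smul_smul]

end RootedTree

theorem exists_equiv_prod_of_free {H X : Type*} [Group H] [MulAction H X]
    (hfree : ∀ (h : H) (x : X), h • x = x → h = 1) :
    ∃ e : X ≃ MulAction.orbitRel.Quotient H X × H, ∀ (h : H) x, e (h • x) = ((e x).1, h * (e x).2) := by
  let f : MulAction.orbitRel.Quotient H X × H → X := fun p => p.2 • Quotient.out p.1
  have hf1 : ∀ p, (Quotient.mk'' (f p) : MulAction.orbitRel.Quotient H X) = p.1 := fun p => by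
    rw [← Quotient.out_eq' p.1]
    refine Quotient.sound' ⟨p.2, ?_⟩
    simp only [f]
  have hf : Function.Bijective f := by
    constructor
    · rintro ⟨ω, h⟩ ⟨ω', h'⟩ heq
      have h1 : ω = ω' := (hf1 (ω, h)).symm.trans ((congrArg _ heq).trans (hf1 (ω', h')))
      subst h1
      have h2 : h • Quotient.out ω = h' • Quotient.out ω := heq
      have h3 := hfree (h'⁻¹ * h) (Quotient.out ω) (by rw [mul_smul, h2, inv_smul_smul])
      rw [inv_mul_eq_one] at h3
      rw [h3]
    · intro x
      obtain ⟨h, hh⟩ : x ∈ MulAction.orbit H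
          (Quotient.out (Quotient.mk'' x : MulAction.orbitRel.Quotient H X)) :=
        Quotient.exact' (Quotient.out_eq' (Quotient.mk'' x : MulAction.orbitRel.Quotient H X)).symm
      exact ⟨(Quotient.mk'' x, h), hh⟩
  let e := Equiv.ofBijective f hf
  refine ⟨e.symm, fun h x => ?_⟩
  obtain ⟨p, rfl⟩ := e.surjective x
  rw [Equiv.symm_apply_apply, Equiv.symm_apply_eq]
  exact (mul_smul h p.2 _).symm

theorem exists_equivariant_equiv {H X X' : Type*} [Group H] [MulAction H X] [MulAction H X']
    (hfree : ∀ (h : H) (x : X), h • x = x → h = 1)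
    (hfree' : ∀ (h : H) (x : X'), h • x = x → h = 1) [Finite X] [Finite X']
    (hcard : Nat.card X = Nat.card X') : ∃ e : X ≃ X', ∀ (h : H) x, e (h • x) = h • e x := by
  rcases isEmpty_or_nonempty X with hX | ⟨⟨x₀⟩⟩
  · have : IsEmpty X' := by
      rw [Nat.card_of_isEmpty] at hcard
      exact (Finite.card_eq_zero_iff.1 hcard.symm)
    exact ⟨Equiv.equivOfIsEmpty X X', fun h x => hX.elim x⟩
  · obtain ⟨e, he⟩ := exists_equiv_prod_of_free hfree
    obtain ⟨e', he'⟩ := exists_equiv_prod_of_free hfree'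
    have : Finite H := by
      refine Finite.of_injective (fun h : H => h • x₀) fun h h' heq => ?_
      have h3 := hfree (h'⁻¹ * h) x₀ (by rw [mul_smul, show h • x₀ = h' • x₀ from heq, inv_smul_smul])
      rwa [inv_mul_eq_one, eq_comm] at h3
    have : Nat.card (MulAction.orbitRel.Quotient H X) = Nat.card (MulAction.orbitRel.Quotient H X') := by
      rw [Nat.card_congr e, Nat.card_congr e', Nat.card_prod, Nat.card_prod] at hcard
      exact Nat.eq_of_mul_eq_mul_right Nat.card_pos hcard
    obtain ⟨i⟩ := (Finite.card_eq).1 this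
    let j := (e.trans (i.prodCongr (Equiv.refl H))).trans e'.symm
    refine ⟨j, fun h x => ?_⟩
    simp only [j, Equiv.trans_apply, Equiv.symm_apply_eq, he, he', Equiv.apply_symm_apply,
      Equiv.prodCongr_apply, Equiv.coe_refl]
    rfl

theorem exists_equivariant_section {G B X : Type*} [Group G] [MulAction G B] (act : G → X → X)
    (hact : ∀ g h x, act (g * h) x = act g (act h x)) (R : B → X → Prop)
    (hR : ∀ g b x, R b x → R (g • b) (act g x))
    (h : ∀ b, ∃ x, R b x ∧ ∀ g : G, g • b = b → act g x = x) :
    ∃ f : B → X, (∀ b, R b (f b)) ∧ ∀ g b, f (g • b) = act g (f b) := by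
  choose x hx hx' using h
  let r : B → B := fun b => Quotient.out (Quotient.mk'' b : MulAction.orbitRel.Quotient G B)
  have hr : ∀ b, ∃ g : G, g • r b = b := fun b =>
    Quotient.exact' (Quotient.out_eq' (Quotient.mk'' b : MulAction.orbitRel.Quotient G B)).symm
  choose k hk using hr
  refine ⟨fun b => act (k b) (x (r b)), fun b => ?_, fun g b => ?_⟩
  · have := hR (k b) _ _ (hx (r b))
    rwa [hk] at this
  · have hrb : r (g • b) = r b := by
      simp only [r]
      congr 1
      exact Quotient.sound' ⟨g, rfl⟩
    have hs : ((g * k b)⁻¹ * k (g • b)) • r b = r b := by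
      rw [mul_smul, inv_smul_eq_iff, mul_smul, hk b]
      conv_lhs => rw [← hrb]
      exact hk _
    have h1 := hx' _ _ hs
    simp only [hrb]
    calc act (k (g • b)) (x (r b)) = act (g * k b) (act ((g * k b)⁻¹ * k (g • b)) (x (r b))) := by
          rw [← hact, mul_inv_cancel_left]
      _ = _ := by rw [h1, hact]

theorem virtuallyFree_of_subgroup {G : Type*} [Group G] (H : Subgroup G) [H.FiniteIndex]
    (h : VirtuallyFree H) : VirtuallyFree G := by
  obtain ⟨K, hK, hfree⟩ := h
  refine ⟨K.map H.subtype, ⟨?_⟩, ?_⟩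
  · rw [Subgroup.index_map_subtype]
    exact mul_ne_zero hK.index_ne_zero Subgroup.FiniteIndex.index_ne_zero
  · exact IsFreeGroup.ofMulEquiv (K.equivMapOfInjective H.subtype H.subtype_injective)

/-- Equivariant bijections between the fibres of an equivariant family of finite sets of equal
size. -/
theorem exists_equivariant_transport {G V Y : Type*} [Group G] [MulAction G V] [MulAction G Y]
    (hfree : ∀ (g : G) (y : Y), g • y = y → g = 1) (E : V → Set Y) (hfin : ∀ v, (E v).Finite)
    (hE : ∀ (g : G) v y, y ∈ E v → g • y ∈ E (g • v))
    (hcard : ∀ u v, (E u).ncard = (E v).ncard) :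
    ∃ f : V × V → (Y → Y) × (Y → Y),
      (∀ b, (∀ y ∈ E b.1, (f b).1 y ∈ E b.2 ∧ (f b).2 ((f b).1 y) = y) ∧
        (∀ y ∈ E b.2, (f b).2 y ∈ E b.1 ∧ (f b).1 ((f b).2 y) = y)) ∧
      ∀ (g : G) b y, (f (g • b)).1 (g • y) = g • (f b).1 y ∧
        (f (g • b)).2 (g • y) = g • (f b).2 y := by
  classical
  obtain ⟨f, hf, hf'⟩ := exists_equivariant_section (G := G) (B := V × V)
    (fun (g : G) (t : (Y → Y) × (Y → Y)) =>
      ((fun y => g • t.1 (g⁻¹ • y), fun y => g • t.2 (g⁻¹ • y)) : (Y → Y) × (Y → Y)))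
    (fun g h t => by simp [mul_smul])
    (fun b t => (∀ y ∈ E b.1, t.1 y ∈ E b.2 ∧ t.2 (t.1 y) = y) ∧
        (∀ y ∈ E b.2, t.2 y ∈ E b.1 ∧ t.1 (t.2 y) = y))
    (by
      rintro g ⟨u, v⟩ ⟨t, t'⟩ ⟨h1, h2⟩
      have hE' : ∀ w y, y ∈ E (g • w) → g⁻¹ • y ∈ E w := fun w y hy => by
        simpa using hE g⁻¹ _ _ hy
      refine ⟨fun y hy => ⟨hE _ _ _ (h1 _ (hE' _ _ hy)).1, ?_⟩,
        fun y hy => ⟨hE _ _ _ (h2 _ (hE' _ _ hy)).1, ?_⟩⟩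
      · have h3 := (h1 _ (hE' _ _ hy)).2
        simp only at h3
        simp only [inv_smul_smul, h3, smul_inv_smul]
      · have h3 := (h2 _ (hE' _ _ hy)).2
        simp only at h3
        simp only [inv_smul_smul, h3, smul_inv_smul])
    (by
      rintro ⟨u, v⟩
      let H : Subgroup G := MulAction.stabilizer G u ⊓ MulAction.stabilizer G v
      let X : SubMulAction H Y := ⟨E u, fun h y hy => by
        have := hE h u y hy
        rwa [show (h : G) • u = u from h.2.1] at this⟩
      let X' : SubMulAction H Y := ⟨E v, fun h y hy => by
        have := hE h v y hy
        rwa [show (h : G) • v = v from h.2.2] at this⟩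
      have : Finite X := hfin u
      have : Finite X' := hfin v
      obtain ⟨e, he⟩ := exists_equivariant_equiv (H := H) (X := X) (X' := X')
        (fun h x hx => Subtype.ext (hfree h x (congrArg Subtype.val hx)))
        (fun h x hx => Subtype.ext (hfree h x (congrArg Subtype.val hx))) (hcard u v)
      have he' : ∀ (h : H) x, e.symm (h • x) = h • e.symm x := fun h x => by
        rw [Equiv.symm_apply_eq, he, Equiv.apply_symm_apply]
      refine ⟨(fun y => if h : y ∈ X then e ⟨y, h⟩ else y,
        fun y => if h : y ∈ X' then e.symm ⟨y, h⟩ else y), ⟨fun y hy => ?_, fun y hy => ?_⟩, ?_⟩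
      · have hy' : y ∈ X := hy
        have h2 : (e ⟨y, hy'⟩ : Y) ∈ X' := (e ⟨y, hy'⟩).2
        simp only [hy', dif_pos, h2]
        exact ⟨h2, by simp⟩
      · have hy' : y ∈ X' := hy
        have h2 : (e.symm ⟨y, hy'⟩ : Y) ∈ X := (e.symm ⟨y, hy'⟩).2
        simp only [hy', dif_pos, h2]
        exact ⟨h2, by simp⟩
      · intro g hg
        obtain ⟨hg1, hg2⟩ := Prod.ext_iff.1 hg
        let h : H := ⟨g, hg1, hg2⟩
        have hinv : ∀ y : Y, h • h⁻¹ • y = y := fun y => smul_inv_smul h y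
        refine Prod.ext (funext fun y => ?_) (funext fun y => ?_)
        · show h • (if h' : h⁻¹ • y ∈ X then (e ⟨h⁻¹ • y, h'⟩ : Y) else h⁻¹ • y) = _
          by_cases hy : y ∈ X
          · have hy' : h⁻¹ • y ∈ X := X.smul_mem _ hy
            simp only [hy, hy', dif_pos]
            have h3 : (⟨h⁻¹ • y, hy'⟩ : X) = h⁻¹ • ⟨y, hy⟩ := rfl
            rw [h3, he]
            exact hinv _
          · have hy' : h⁻¹ • y ∉ X := fun h' => hy (by simpa using X.smul_mem h h')
            simp only [hy, hy', dif_neg, not_false_iff]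
            exact hinv _
        · show h • (if h' : h⁻¹ • y ∈ X' then (e.symm ⟨h⁻¹ • y, h'⟩ : Y) else h⁻¹ • y) = _
          by_cases hy : y ∈ X'
          · have hy' : h⁻¹ • y ∈ X' := X'.smul_mem _ hy
            simp only [hy, hy', dif_pos]
            have h3 : (⟨h⁻¹ • y, hy'⟩ : X') = h⁻¹ • ⟨y, hy⟩ := rfl
            rw [h3, he']
            exact hinv _
          · have hy' : h⁻¹ • y ∉ X' := fun h' => hy (by simpa using X'.smul_mem h h')
            simp only [hy, hy', dif_neg, not_false_iff]
            exact hinv _)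
  refine ⟨f, hf, fun g b y => ?_⟩
  simp only [hf', inv_smul_smul, and_self]

/-- A group acting on a rooted tree is virtually free as soon as there is an equivariant family
of nonempty finite subsets, of equal size, of a free `G`-set, indexed by the vertices. -/
theorem virtuallyFree_of_fibres {G V : Type u} {Y : Type*} [Group G] [MulAction G V]
    [MulAction G Y] (T : RootedTree V) (hadj : ∀ (g : G) u v, T.adj u v → T.adj (g • u) (g • v))
    (hfree : ∀ (g : G) (y : Y), g • y = y → g = 1) (E : V → Set Y) (hfin : ∀ v, (E v).Finite)
    (hne : (E T.root).Nonempty) (hE : ∀ (g : G) v y, y ∈ E v → g • y ∈ E (g • v))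
    (hcard : ∀ u v, (E u).ncard = (E v).ncard) : VirtuallyFree G := by
  classical
  obtain ⟨G₀, hG₀, hpar⟩ : ∃ G₀ : Subgroup G, G₀.FiniteIndex ∧ ∀ g ∈ G₀, ∀ v,
      (Even (T.height (g • v)) ↔ Even (T.height v)) := by
    let _ : MulAction G Bool :=
      { smul := fun _ b => b, one_smul := fun _ => rfl, mul_smul := fun _ _ _ => rfl }
    obtain ⟨K, hK, h⟩ := T.exists_finiteIndex_forall_isFlat hadj (Z := Bool) (fun _ => Set.univ)
      (Set.toFinite _) (fun _ _ _ _ => trivial) (fun _ _ b => !b) (fun _ _ _ _ _ _ => rfl)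
    refine ⟨K, hK, fun g hg v => ?_⟩
    have := h g hg (fun v => decide (Even (T.height v))) (fun _ => trivial) (by
      intro u v huv
      have := T.even_height_iff huv
      by_cases hv : Even (T.height v) <;> simp_all) v
    exact decide_eq_decide.1 this
  refine virtuallyFree_of_subgroup G₀ ?_
  obtain ⟨f, hf, hfg⟩ := exists_equivariant_transport hfree E hfin hE hcard
  let τ : V → V → Y → Y := fun u v => if Even (T.height u) then (f (u, v)).1 else (f (v, u)).2
  have hτ : ∀ u v z, T.adj u v → z ∈ E u → τ u v z ∈ E v ∧ τ v u (τ u v z) = z := by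
    intro u v z huv hz
    have := T.even_height_iff huv
    by_cases hu : Even (T.height u)
    · simp only [τ, hu, this.1 hu, if_true, if_false]
      exact (hf (u, v)).1 z hz
    · have hv : Even (T.height v) := by tauto
      simp only [τ, hu, hv, if_true, if_false]
      exact (hf (v, u)).2 z hz
  obtain ⟨z₀, hz₀⟩ := hne
  obtain ⟨σ, -, hσE, hσ⟩ := T.exists_isFlat (fun v z => z ∈ E v) τ hτ hz₀
  obtain ⟨K, hK, hKσ⟩ := T.exists_finiteIndex_forall_isFlat (G := G₀)
    (fun g u v => hadj g u v) E (hfin _) (fun g => hE g) τ (by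
      rintro ⟨g, hg⟩ u v z - -
      show τ (g • u) (g • v) (g • z) = g • τ u v z
      simp only [τ, hpar g hg]
      split_ifs
      · exact (hfg g (u, v) z).1
      · exact (hfg g (v, u) z).2)
  refine ⟨K, hK, T.isFreeGroup_of_free_action (fun k u v => hadj _ u v)
    (fun k v => hpar _ k.1.2 v) fun k v hkv => ?_⟩
  have := hKσ k k.2 σ hσE hσ v
  rw [show (k : G₀) • v = v from hkv] at this
  exact Subtype.ext (Subtype.ext (hfree _ _ this.symm))

open scoped Nat in
/-- A group acting on a rooted tree is virtually free as soon as there is an equivariant family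
of nonempty finite subsets of `G`, of bounded size, indexed by the vertices. -/
theorem virtuallyFree_of_rootedTree {G V : Type u} [Group G] [MulAction G V] (T : RootedTree V)
    (hadj : ∀ (g : G) u v, T.adj u v → T.adj (g • u) (g • v)) (S : V → Set G)
    (hfin : ∀ v, (S v).Finite) (hne : ∀ v, (S v).Nonempty)
    (hS : ∀ (g : G) v y, y ∈ S v → g * y ∈ S (g • v)) {b : ℕ} (hb : ∀ v, (S v).ncard ≤ b) :
    VirtuallyFree G := by
  let _ : MulAction G (G × ℕ) :=
    { smul := fun g p => (g * p.1, p.2)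
      one_smul := fun p => Prod.ext (one_mul _) rfl
      mul_smul := fun g h p => Prod.ext (mul_assoc _ _ _) rfl }
  have hpos : ∀ v, 0 < (S v).ncard := fun v => (Set.ncard_pos (hfin v)).2 (hne v)
  have hN : ∀ v, (S v ×ˢ Set.Iio (b ! / (S v).ncard)).ncard = b ! := fun v => by
    rw [Set.ncard_prod, Set.ncard_eq_toFinset_card' (Set.Iio _)]
    simp only [Set.toFinset_Iio, Nat.card_Iio]
    exact Nat.mul_div_cancel' (Nat.dvd_factorial (hpos v) (hb v))
  have hSg : ∀ (g : G) v, (S (g • v)).ncard = (S v).ncard := fun g v => by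
    have : S (g • v) = (fun y => g * y) '' S v := by
      ext y
      constructor
      · intro hy
        exact ⟨g⁻¹ * y, by simpa using hS g⁻¹ _ _ hy, by simp⟩
      · rintro ⟨y, hy, rfl⟩
        exact hS g v y hy
    rw [this, Set.ncard_image_of_injective _ (mul_right_injective g)]
  refine virtuallyFree_of_fibres (Y := G × ℕ) T hadj ?_
    (fun v => S v ×ˢ Set.Iio (b ! / (S v).ncard)) (fun v => (hfin v).prod (Set.finite_Iio _)) ?_ ?_
    (fun u v => by rw [hN, hN])
  · intro g y hy
    exact mul_eq_right.1 (congrArg Prod.fst hy)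
  · refine Set.nonempty_of_ncard_ne_zero ?_
    rw [hN]
    exact Nat.factorial_ne_zero b
  · rintro g v ⟨y, i⟩ ⟨h1, h2⟩
    refine ⟨hS g v y h1, ?_⟩
    show i < _
    rw [hSg]
    exact h2

end Trees

section NestedSets

universe u

/-- A nested family of nonempty sets, closed under complements, with finitely many members
separating two given points. -/
structure IsNestedFamily {α : Type u} (𝓔 : Set (Set α)) : Prop where
  compl_mem : ∀ {C}, C ∈ 𝓔 → Cᶜ ∈ 𝓔
  nonempty : ∀ {C}, C ∈ 𝓔 → C.Nonempty
  nested : ∀ {C D}, C ∈ 𝓔 → D ∈ 𝓔 → C ⊆ D ∨ D ⊆ C ∨ C ⊆ Dᶜ ∨ Cᶜ ⊆ D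
  finite : ∀ x y, {C | C ∈ 𝓔 ∧ x ∈ C ∧ y ∉ C}.Finite

/-- The consistent choices of one side of each member of `𝓔`, almost always containing `o`. -/
structure IsOrientation {α : Type u} (𝓔 : Set (Set α)) (o : α) (O : Set (Set α)) : Prop where
  subset : O ⊆ 𝓔
  mem_or_compl_mem : ∀ {C}, C ∈ 𝓔 → C ∈ O ∨ Cᶜ ∈ O
  compl_notMem : ∀ {C}, C ∈ O → Cᶜ ∉ O
  mem_of_superset : ∀ {C D}, C ∈ O → D ∈ 𝓔 → C ⊆ D → D ∈ O
  finite : {C | C ∈ O ∧ o ∉ C}.Finite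

/-- Replace a member of an orientation by its complement. -/
def flip {α : Type u} (O : Set (Set α)) (C : Set α) : Set (Set α) :=
  {D | (D ∈ O ∧ D ≠ C) ∨ D = Cᶜ}

variable {α : Type u} {𝓔 : Set (Set α)} {o : α} {O : Set (Set α)} {C : Set α}

theorem IsNestedFamily.isOrientation_root (h𝓔 : IsNestedFamily 𝓔) :
    IsOrientation 𝓔 o {C | C ∈ 𝓔 ∧ o ∈ C} where
  subset := fun C hC => hC.1
  mem_or_compl_mem := fun {C} hC => by
    by_cases h : o ∈ C
    · exact Or.inl ⟨hC, h⟩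
    · exact Or.inr ⟨h𝓔.compl_mem hC, h⟩
  compl_notMem := fun h h' => h'.2 h.2
  mem_of_superset := fun h1 h2 h3 => ⟨h2, h3 h1.2⟩
  finite := by
    convert Set.finite_empty
    exact Set.eq_empty_of_forall_notMem fun C hC => hC.2 hC.1.2

theorem IsOrientation.not_subset_compl (hO : IsOrientation 𝓔 o O) (h𝓔 : IsNestedFamily 𝓔)
    {C D : Set α} (hC : C ∈ O) (hD : D ∈ O) : ¬ C ⊆ Dᶜ :=
  fun h => hO.compl_notMem hD (hO.mem_of_superset hC (h𝓔.compl_mem (hO.subset hD)) h)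

theorem IsOrientation.flip (hO : IsOrientation 𝓔 o O) (h𝓔 : IsNestedFamily 𝓔) (hC : C ∈ O)
    (hmin : ∀ D ∈ O, D ⊆ C → D = C) : IsOrientation 𝓔 o (flip O C) where
  subset := by
    rintro D (hD | rfl)
    · exact hO.subset hD.1
    · exact h𝓔.compl_mem (hO.subset hC)
  mem_or_compl_mem := fun {D} hD => by
    by_cases h1 : D = C
    · exact Or.inr (Or.inr (by rw [h1]))
    by_cases h2 : D = Cᶜ
    · exact Or.inl (Or.inr h2)
    have h3 : Dᶜ ≠ C := fun h => h2 (by rw [← h, compl_compl])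
    rcases hO.mem_or_compl_mem hD with h | h
    · exact Or.inl (Or.inl ⟨h, h1⟩)
    · exact Or.inr (Or.inl ⟨h, h3⟩)
  compl_notMem := by
    rintro D (⟨hD, hDC⟩ | rfl) (⟨hD', hDC'⟩ | h')
    · exact hO.compl_notMem hD hD'
    · exact hDC (compl_injective h')
    · exact hDC' (compl_compl C)
    · obtain ⟨x, hx⟩ := h𝓔.nonempty (hO.subset hC)
      rw [compl_compl] at h'
      have hx' := hx
      rw [h'] at hx'
      exact hx' hx
  mem_of_superset := by
    rintro X Y (⟨hX, hXC⟩ | rfl) hY hXY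
    · refine Or.inl ⟨hO.mem_of_superset hX hY hXY, ?_⟩
      rintro rfl
      exact hXC (hmin X hX hXY)
    · rcases hO.mem_or_compl_mem hY with h | h
      · refine Or.inl ⟨h, ?_⟩
        rintro rfl
        obtain ⟨x, hx⟩ := h𝓔.nonempty (h𝓔.compl_mem hY)
        exact hx (hXY hx)
      · have := hmin _ h (Set.compl_subset_comm.1 hXY)
        exact Or.inr (by rw [← this, compl_compl])
  finite := by
    refine (hO.finite.union (Set.finite_singleton Cᶜ)).subset ?_
    rintro D ⟨h1 | h1, h2⟩
    · exact Or.inl ⟨h1.1, h2⟩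
    · exact Or.inr h1

theorem IsOrientation.exists_least (hO : IsOrientation 𝓔 o O) (h𝓔 : IsNestedFamily 𝓔)
    (hne : O ≠ {C | C ∈ 𝓔 ∧ o ∈ C}) :
    ∃ C, (C ∈ O ∧ o ∉ C) ∧ ∀ D ∈ O, o ∉ D → C ⊆ D := by
  have h1 : {C | C ∈ O ∧ o ∉ C}.Nonempty := by
    by_contra hcon
    rw [Set.not_nonempty_iff_eq_empty] at hcon
    have h2 : ∀ C ∈ O, o ∈ C := fun C hC => by
      by_contra ho
      exact hcon.subset (show C ∈ {C | C ∈ O ∧ o ∉ C} from ⟨hC, ho⟩)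
    refine hne (Set.Subset.antisymm (fun C hC => ⟨hO.subset hC, h2 C hC⟩) fun C hC => ?_)
    rcases hO.mem_or_compl_mem hC.1 with h | h
    · exact h
    · exact absurd hC.2 (h2 _ h)
  obtain ⟨C, hC⟩ := hO.finite.exists_minimal h1
  refine ⟨C, hC.prop, fun D hD hoD => ?_⟩
  rcases h𝓔.nested (hO.subset hC.prop.1) (hO.subset hD) with h | h | h | h
  · exact h
  · exact hC.le_of_le ⟨hD, hoD⟩ h
  · exact absurd h (hO.not_subset_compl h𝓔 hC.prop.1 hD)
  · exact absurd (h hC.prop.2) hoD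

theorem flip_flip (hC : C ∈ O) (hC' : Cᶜ ∉ O) : flip (flip O C) Cᶜ = O := by
  ext D
  simp only [flip, Set.mem_ofPred_eq, compl_compl]
  constructor
  · rintro (⟨h | h, h'⟩ | h)
    · exact h.1
    · exact absurd h h'
    · rwa [h]
  · intro hD
    by_cases h : D = C
    · exact Or.inr h
    · refine Or.inl ⟨Or.inl ⟨hD, h⟩, ?_⟩
      rintro rfl
      exact hC' hD

/-- The member of the orientation to be flipped in order to approach the root. -/
noncomputable def leastCut (h𝓔 : IsNestedFamily 𝓔) (O : {O // IsOrientation 𝓔 o O})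
    (h : O.1 ≠ {C | C ∈ 𝓔 ∧ o ∈ C}) : Set α :=
  (O.2.exists_least h𝓔 h).choose

theorem leastCut_mem (h𝓔 : IsNestedFamily 𝓔) (O : {O // IsOrientation 𝓔 o O})
    (h : O.1 ≠ {C | C ∈ 𝓔 ∧ o ∈ C}) : leastCut h𝓔 O h ∈ O.1 :=
  (O.2.exists_least h𝓔 h).choose_spec.1.1

theorem notMem_leastCut (h𝓔 : IsNestedFamily 𝓔) (O : {O // IsOrientation 𝓔 o O})
    (h : O.1 ≠ {C | C ∈ 𝓔 ∧ o ∈ C}) : o ∉ leastCut h𝓔 O h :=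
  (O.2.exists_least h𝓔 h).choose_spec.1.2

theorem leastCut_subset (h𝓔 : IsNestedFamily 𝓔) (O : {O // IsOrientation 𝓔 o O})
    (h : O.1 ≠ {C | C ∈ 𝓔 ∧ o ∈ C}) {D : Set α} (hD : D ∈ O.1) (hoD : o ∉ D) :
    leastCut h𝓔 O h ⊆ D :=
  (O.2.exists_least h𝓔 h).choose_spec.2 D hD hoD

open Classical in
/-- The neighbour of an orientation closer to the root. -/
noncomputable def parentOrientation (h𝓔 : IsNestedFamily 𝓔) (O : {O // IsOrientation 𝓔 o O}) :
    {O // IsOrientation 𝓔 o O} :=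
  if h : O.1 ≠ {C | C ∈ 𝓔 ∧ o ∈ C} then
    ⟨flip O.1 (leastCut h𝓔 O h), O.2.flip h𝓔 (leastCut_mem h𝓔 O h) fun _ hD hDC =>
      hDC.antisymm (leastCut_subset h𝓔 O h hD fun ho => notMem_leastCut h𝓔 O h (hDC ho))⟩
  else O

theorem parentOrientation_val (h𝓔 : IsNestedFamily 𝓔) (O : {O // IsOrientation 𝓔 o O})
    (h : O.1 ≠ {C | C ∈ 𝓔 ∧ o ∈ C}) :
    (parentOrientation h𝓔 O).1 = flip O.1 (leastCut h𝓔 O h) := by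
  rw [parentOrientation, dif_pos h]

theorem eq_parentOrientation (h𝓔 : IsNestedFamily 𝓔) {O O' : {O // IsOrientation 𝓔 o O}}
    (hC : C ∈ O.1) (ho : o ∉ C) (hO' : O'.1 = flip O.1 C) :
    O.1 ≠ {C | C ∈ 𝓔 ∧ o ∈ C} ∧ O' = parentOrientation h𝓔 O := by
  have hne : O.1 ≠ {C | C ∈ 𝓔 ∧ o ∈ C} := fun h => ho (h.subset hC).2
  refine ⟨hne, Subtype.ext ?_⟩
  rw [parentOrientation_val h𝓔 O hne, hO']
  congr 1
  have hsub := leastCut_subset h𝓔 O hne hC ho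
  by_contra hCne
  have h1 : leastCut h𝓔 O hne ∈ O'.1 := by
    rw [hO']
    exact Or.inl ⟨leastCut_mem h𝓔 O hne, fun h => hCne h.symm⟩
  have h2 : Cᶜ ∈ O'.1 := by
    rw [hO']
    exact Or.inr rfl
  exact O'.2.compl_notMem (O'.2.mem_of_superset h1 (O.2.subset hC) hsub) h2

/-- The tree of orientations of a nested family of sets. -/
noncomputable def orientationTree (h𝓔 : IsNestedFamily 𝓔) (o : α) :
    RootedTree {O // IsOrientation 𝓔 o O} where
  adj O O' := ∃ C ∈ O.1, O'.1 = flip O.1 C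
  root := ⟨_, h𝓔.isOrientation_root⟩
  height O := {C | C ∈ O.1 ∧ o ∉ C}.ncard
  parent := parentOrientation h𝓔
  symm := by
    rintro O O' ⟨C, hC, hO'⟩
    refine ⟨Cᶜ, ?_, ?_⟩
    · rw [hO']
      exact Or.inr rfl
    · rw [hO', flip_flip hC (O.2.compl_notMem hC)]
  eq_root_of_height := by
    intro O h
    rw [Set.ncard_eq_zero O.2.finite] at h
    refine Subtype.ext ?_
    by_contra hne
    exact h.subset ⟨leastCut_mem h𝓔 O hne, notMem_leastCut h𝓔 O hne⟩
  height_root := by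
    rw [Set.ncard_eq_zero h𝓔.isOrientation_root.finite]
    exact Set.eq_empty_of_forall_notMem fun C hC => hC.2 hC.1.2
  adj_parent := by
    intro O hO
    have hne : O.1 ≠ {C | C ∈ 𝓔 ∧ o ∈ C} := fun h => hO (Subtype.ext h)
    have hval := parentOrientation_val h𝓔 O hne
    refine ⟨(leastCut h𝓔 O hne)ᶜ, ?_, ?_⟩
    · rw [hval]
      exact Or.inr rfl
    · rw [hval, flip_flip (leastCut_mem h𝓔 O hne) (O.2.compl_notMem (leastCut_mem h𝓔 O hne))]
  height_parent := by
    intro O hO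
    have hne : O.1 ≠ {C | C ∈ 𝓔 ∧ o ∈ C} := fun h => hO (Subtype.ext h)
    have hmem : leastCut h𝓔 O hne ∈ {C | C ∈ O.1 ∧ o ∉ C} :=
      ⟨leastCut_mem h𝓔 O hne, notMem_leastCut h𝓔 O hne⟩
    rw [← Set.ncard_sdiff_singleton_add_one hmem O.2.finite, parentOrientation_val h𝓔 O hne]
    congr 2
    ext D
    constructor
    · rintro ⟨h1, h2⟩
      exact ⟨Or.inl ⟨h1.1, h2⟩, h1.2⟩
    · rintro ⟨h1 | h1, h2⟩
      · exact ⟨⟨h1.1, h2⟩, h1.2⟩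
      · rw [h1] at h2
        exact absurd (notMem_leastCut h𝓔 O hne) h2
  eq_parent_or := by
    rintro O O' ⟨C, hC, hO'⟩
    by_cases ho : o ∈ C
    · obtain ⟨h1, h2⟩ := eq_parentOrientation h𝓔 (O := O') (O' := O) (C := Cᶜ)
        (by rw [hO']; exact Or.inr rfl) (fun h => h ho)
        (by rw [hO', flip_flip hC (O.2.compl_notMem hC)])
      exact Or.inl ⟨fun h => h1 (congrArg Subtype.val h), h2⟩
    · obtain ⟨h1, h2⟩ := eq_parentOrientation h𝓔 hC ho hO'
      exact Or.inr ⟨fun h => h1 (congrArg Subtype.val h), h2⟩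

end NestedSets

section TranslatedOrientations

universe u

variable {G : Type u} [Group G] {𝓔 : Set (Set G)}

theorem IsOrientation.translate (h𝓔 : IsNestedFamily 𝓔)
    (hinv : ∀ (g : G), ∀ C ∈ 𝓔, (fun x => g * x) ⁻¹' C ∈ 𝓔) {O : Set (Set G)}
    (hO : IsOrientation 𝓔 1 O) (g : G) :
    IsOrientation 𝓔 1 {C | (fun x => g * x) ⁻¹' C ∈ O} where
  subset := fun C hC => by
    have := hinv g⁻¹ _ (hO.subset hC)
    simpa [← Set.preimage_comp, Function.comp_def] using this
  mem_or_compl_mem := fun {C} hC => hO.mem_or_compl_mem (hinv g C hC)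
  compl_notMem := fun {C} hC => hO.compl_notMem hC
  mem_of_superset := fun {C D} hC hD hCD =>
    hO.mem_of_superset hC (hinv g D hD) (Set.preimage_mono hCD)
  finite := by
    refine Set.Finite.subset (((hO.finite.union (h𝓔.finite 1 g⁻¹))).preimage
      (f := fun C => (fun x => g * x) ⁻¹' C)
      (Function.Surjective.preimage_injective (mul_left_surjective g)).injOn) ?_
    rintro C ⟨h1, h2⟩
    by_cases h : (1 : G) ∈ (fun x => g * x) ⁻¹' C
    · exact Or.inr ⟨hO.subset h1, h, by simpa using h2⟩
    · exact Or.inl ⟨h1, h⟩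

/-- The action of `G` on orientations by translation. -/
abbrev orientationAction (h𝓔 : IsNestedFamily 𝓔)
    (hinv : ∀ (g : G), ∀ C ∈ 𝓔, (fun x => g * x) ⁻¹' C ∈ 𝓔) :
    MulAction G {O // IsOrientation 𝓔 1 O} where
  smul g O := ⟨_, O.2.translate h𝓔 hinv g⟩
  one_smul O := Subtype.ext (by
    show {C | (fun x => 1 * x) ⁻¹' C ∈ O.1} = O.1
    simp)
  mul_smul g h O := Subtype.ext (by
    show {C | (fun x => g * h * x) ⁻¹' C ∈ O.1} =
      {C | (fun x => h * x) ⁻¹' ((fun x => g * x) ⁻¹' C) ∈ O.1}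
    simp [← Set.preimage_comp, Function.comp_def, mul_assoc])

theorem flip_translate (O : Set (Set G)) (C : Set G) (g : G) :
    {D | (fun x => g * x) ⁻¹' D ∈ flip O C} =
      flip {D | (fun x => g * x) ⁻¹' D ∈ O} ((fun x => g⁻¹ * x) ⁻¹' C) := by
  have key : ∀ D C : Set G, (fun x => g * x) ⁻¹' D = C ↔ D = (fun x => g⁻¹ * x) ⁻¹' C := by
    intro D C
    constructor
    · rintro rfl
      simp [← Set.preimage_comp, Function.comp_def]
    · rintro rfl
      simp [← Set.preimage_comp, Function.comp_def]
  ext D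
  simp only [flip, Set.mem_ofPred_eq, ne_eq, key, Set.preimage_compl]

/-- A group with an invariant nested family of sets is virtually free, if the sets of points close
to all members of an orientation are nonempty and uniformly finite. -/
theorem virtuallyFree_of_isNestedFamily (h𝓔 : IsNestedFamily 𝓔)
    (hinv : ∀ (g : G), ∀ C ∈ 𝓔, (fun x => g * x) ⁻¹' C ∈ 𝓔) (S : Set (Set G) → Set G) {b : ℕ}
    (hne : ∀ O, IsOrientation 𝓔 1 O → (S O).Nonempty)
    (hS : ∀ (g : G) O x, x ∈ S O → g * x ∈ S {C | (fun x => g * x) ⁻¹' C ∈ O})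
    (hfin : ∀ O, IsOrientation 𝓔 1 O → (S O).Finite ∧ (S O).ncard ≤ b) : VirtuallyFree G := by
  let _ := orientationAction h𝓔 hinv
  refine virtuallyFree_of_rootedTree (orientationTree h𝓔 1) ?_ (fun O => S O.1)
    (fun O => (hfin O.1 O.2).1) (fun O => hne O.1 O.2) (fun g O x hx => hS g O.1 x hx)
    (fun O => (hfin O.1 O.2).2)
  rintro g O O' ⟨C, hC, hO'⟩
  refine ⟨(fun x => g⁻¹ * x) ⁻¹' C, ?_, ?_⟩
  · show (fun x => g * x) ⁻¹' ((fun x => g⁻¹ * x) ⁻¹' C) ∈ O.1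
    simpa [← Set.preimage_comp, Function.comp_def] using hC
  · show {D | (fun x => g * x) ⁻¹' D ∈ O'.1} = _
    rw [hO', flip_translate]
    rfl

end TranslatedOrientations

section Bottleneck

variable {V : Type*} {Γ : SimpleGraph V}

/-- Every walk passes within distance `D` of every point of a geodesic between its ends. -/
def Bottleneck (Γ : SimpleGraph V) (D : ℕ) : Prop :=
  ∀ ⦃x y z : V⦄ (w : Γ.Walk x y), Γ.dist x z + Γ.dist z y = Γ.dist x y →
    ∃ p ∈ w.support, Γ.dist z p ≤ D

/-- The closed ball in the graph metric. -/
def distBall (Γ : SimpleGraph V) (m : V) (r : ℕ) : Set V :=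
  {p | Γ.dist m p ≤ r}

theorem dist_getVert_add_le (hΓ : Γ.Connected) {x y : V} (w : Γ.Walk x y) (i k : ℕ) :
    Γ.dist (w.getVert i) (w.getVert (i + k)) ≤ k := by
  induction k with
  | zero => simp
  | succ k ih =>
    have h1 : Γ.dist (w.getVert (i + k)) (w.getVert (i + k + 1)) ≤ 1 := by
      by_cases h : i + k < w.length
      · exact (SimpleGraph.dist_eq_one_iff_adj.2 (w.adj_getVert_succ h)).le
      · rw [w.getVert_of_length_le (by omega), w.getVert_of_length_le (by omega)]
        simp
    have := hΓ.dist_triangle (u := w.getVert i) (v := w.getVert (i + k))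
      (w := w.getVert (i + k + 1))
    rw [← add_assoc]
    omega

theorem dist_getVert_add (hΓ : Γ.Connected) {x y : V} {w : Γ.Walk x y}
    (hw : w.length = Γ.dist x y) {i k : ℕ} (hik : i + k ≤ w.length) :
    Γ.dist (w.getVert i) (w.getVert (i + k)) = k := by
  refine le_antisymm (dist_getVert_add_le hΓ w i k) ?_
  have h1 := dist_getVert_add_le hΓ w 0 i
  have h2 := dist_getVert_add_le hΓ w (i + k) (w.length - (i + k))
  rw [Nat.add_sub_cancel' hik, w.getVert_length] at h2
  rw [zero_add, w.getVert_zero] at h1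
  have h3 := hΓ.dist_triangle (u := x) (v := w.getVert i) (w := w.getVert (i + k))
  have h4 := hΓ.dist_triangle (u := x) (v := w.getVert (i + k)) (w := y)
  omega

theorem dist_getVert (hΓ : Γ.Connected) {x y : V} {w : Γ.Walk x y}
    (hw : w.length = Γ.dist x y) {i j : ℕ} (hi : i ≤ w.length) (hj : j ≤ w.length) :
    (Γ.dist (w.getVert i) (w.getVert j) : ℤ) = |(i : ℤ) - j| := by
  rcases le_total i j with h | h
  · obtain ⟨k, rfl⟩ := Nat.exists_eq_add_of_le h
    rw [dist_getVert_add hΓ hw hj]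
    simp
  · obtain ⟨k, rfl⟩ := Nat.exists_eq_add_of_le h
    rw [SimpleGraph.dist_comm, dist_getVert_add hΓ hw hi]
    simp

/-- The vertices reachable from `x` outside `B`. -/
def reachableOff (Γ : SimpleGraph V) (B : Set V) (x : V) : Set V :=
  {y | ∃ w : Γ.Walk x y, ∀ p ∈ w.support, p ∉ B}

theorem reachableOff_of_adj {B : Set V} {x y z : V} (hy : y ∈ reachableOff Γ B x)
    (hyz : Γ.Adj y z) (hz : z ∉ B) : z ∈ reachableOff Γ B x := by
  obtain ⟨w, hw⟩ := hy
  refine ⟨w.concat hyz, fun p hp => ?_⟩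
  rw [SimpleGraph.Walk.support_concat] at hp
  simp only [List.mem_append, List.mem_singleton] at hp
  rcases hp with hp | rfl
  · exact hw p hp
  · exact hz

theorem edgeCut_reachableOff_subset (hΓ : Γ.Connected) (m x : V) (D : ℕ) :
    edgeCut Γ (reachableOff Γ (distBall Γ m D) x) ⊆ distBall Γ m (D + 1) ×ˢ distBall Γ m D := by
  rintro ⟨p, q⟩ ⟨hpq, hp, hq⟩
  have hqB : q ∈ distBall Γ m D := by
    by_contra hqB
    exact hq (reachableOff_of_adj hp hpq hqB)
  refine ⟨?_, hqB⟩
  have h1 : Γ.dist q p = 1 := SimpleGraph.dist_eq_one_iff_adj.2 hpq.symm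
  have h2 := hΓ.dist_triangle (u := m) (v := q) (w := p)
  have h3 : Γ.dist m q ≤ D := hqB
  show Γ.dist m p ≤ D + 1
  omega

end Bottleneck

section Group

variable {G : Type*} [Group G] {A : Set G}

theorem bottleneck_of_thin (hgen : Subgroup.closure A = ⊤) {δ : ℝ}
    (h : ∀ P : DiscPolygon G A, ∀ t ≤ P.m P.n,
      ∃ j < P.n, ∃ u ≤ P.m j, (wordDist A (P.γ P.n t) (P.γ j u) : ℝ) ≤ δ) :
    Bottleneck (cayleyGraph A) ⌊δ⌋₊ := by
  intro x y z w hz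
  have hc := cayleyGraph_connected hgen
  rcases Nat.eq_zero_or_pos w.length with h0 | h0
  · obtain rfl := w.eq_of_length_eq_zero h0
    have : (cayleyGraph A).dist z x = 0 := by
      rw [SimpleGraph.dist_self] at hz
      omega
    exact ⟨x, w.start_mem_support, by omega⟩
  obtain ⟨p, hp⟩ := hc.exists_walk_length_eq_dist y z
  obtain ⟨q, hq⟩ := hc.exists_walk_length_eq_dist z x
  have hpq : (p.append q).length = (cayleyGraph A).dist y x := by
    rw [SimpleGraph.Walk.length_append, hp, hq]
    rw [SimpleGraph.dist_comm (u := y) (v := z), SimpleGraph.dist_comm (u := z) (v := x),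
      SimpleGraph.dist_comm (u := y) (v := x)]
    omega
  let P : DiscPolygon G A :=
    { n := w.length
      one_le_n := h0
      m := fun i => if i < w.length then 1 else (p.append q).length
      γ := fun i t => if i < w.length then (if t = 0 then w.getVert i else w.getVert (i + 1))
        else (p.append q).getVert t
      geodesic := by
        intro i hi s hs t ht
        rw [wordDist_eq_dist hgen]
        by_cases hin : i < w.length
        · simp only [hin, if_true] at hs ht ⊢
          have h1 : (cayleyGraph A).dist (w.getVert i) (w.getVert (i + 1)) = 1 :=
            SimpleGraph.dist_eq_one_iff_adj.2 (w.adj_getVert_succ hin)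
          interval_cases s <;> interval_cases t <;> simp [h1, SimpleGraph.dist_comm]
        · simp only [hin, if_false] at hs ht ⊢
          exact dist_getVert hc hpq hs ht
      chain := by
        intro i hi
        by_cases hin : i + 1 < w.length
        · simp [hi, hin]
        · have : i + 1 = w.length := by omega
          simp [hi, this]
      closed := by simp [h0, -SimpleGraph.Walk.length_append] }
  obtain ⟨j, hj, u, -, hju⟩ := h P p.length (by
    show p.length ≤ if w.length < w.length then 1 else (p.append q).length
    simp)
  have hjw : j < w.length := hj
  have hzP : P.γ P.n p.length = z := by
    show (if w.length < w.length then _ else (p.append q).getVert p.length) = z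
    simp [SimpleGraph.Walk.getVert_append]
  rw [hzP, wordDist_eq_dist hgen] at hju
  refine ⟨P.γ j u, ?_, Nat.le_floor hju⟩
  show (if j < w.length then (if u = 0 then w.getVert j else w.getVert (j + 1))
    else (p.append q).getVert u) ∈ w.support
  rw [if_pos hjw]
  split_ifs <;> exact w.getVert_mem_support _

theorem finite_distBall (hA : A.Finite) (hgen : Subgroup.closure A = ⊤) (m : G) (r : ℕ) :
    (distBall (cayleyGraph A) m r).Finite := by
  have hc := cayleyGraph_connected hgen
  induction r with
  | zero =>
    refine (Set.finite_singleton m).subset fun p hp => ?_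
    have h : (cayleyGraph A).dist m p = 0 := Nat.le_zero.1 hp
    exact ((hc.dist_eq_zero_iff).1 h).symm
  | succ r ih =>
    refine (ih.union (Set.Finite.image2 (fun p a => p * a) ih (hA.union hA.inv))).subset ?_
    intro p hp
    have hp' : (cayleyGraph A).dist m p ≤ r + 1 := hp
    obtain ⟨w, hw⟩ := hc.exists_walk_length_eq_dist m p
    rcases Nat.lt_or_ge w.length (r + 1) with h | h
    · left
      show (cayleyGraph A).dist m p ≤ r
      omega
    · right
      have hadj := w.adj_getVert_succ (i := r) (by omega)
      rw [w.getVert_of_length_le (i := r + 1) (by omega)] at hadj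
      refine ⟨w.getVert r, ?_, _, hadj.2, by simp⟩
      have := dist_getVert_add_le hc w 0 r
      rw [zero_add, w.getVert_zero] at this
      exact this

theorem ncard_distBall (hgen : Subgroup.closure A = ⊤) (m : G) (r : ℕ) :
    (distBall (cayleyGraph A) m r).ncard = (distBall (cayleyGraph A) 1 r).ncard := by
  rw [← Set.ncard_image_of_injective (distBall (cayleyGraph A) 1 r) (mul_right_injective m)]
  congr 1
  ext p
  constructor
  · intro hp
    refine ⟨m⁻¹ * p, ?_, by simp⟩
    have h := dist_mul_left hgen m⁻¹ m p
    rw [inv_mul_cancel] at h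
    show (cayleyGraph A).dist 1 (m⁻¹ * p) ≤ r
    rw [h]
    exact hp
  · rintro ⟨q, hq, rfl⟩
    show (cayleyGraph A).dist m (m * q) ≤ r
    have h := dist_mul_left hgen m 1 q
    rw [mul_one] at h
    rw [h]
    exact hq

theorem finite_edgeCut_reachableOff (hA : A.Finite) (hgen : Subgroup.closure A = ⊤) (m x : G)
    (D : ℕ) : (edgeCut (cayleyGraph A)
      (reachableOff (cayleyGraph A) (distBall (cayleyGraph A) m D) x)).Finite :=
  ((finite_distBall hA hgen m _).prod (finite_distBall hA hgen m _)).subset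
    (edgeCut_reachableOff_subset (cayleyGraph_connected hgen) m x D)

theorem ncard_edgeCut_reachableOff_le (hA : A.Finite) (hgen : Subgroup.closure A = ⊤) (m x : G)
    (D : ℕ) : (edgeCut (cayleyGraph A)
      (reachableOff (cayleyGraph A) (distBall (cayleyGraph A) m D) x)).ncard ≤
      (distBall (cayleyGraph A) 1 (D + 1)).ncard * (distBall (cayleyGraph A) 1 D).ncard := by
  rw [← ncard_distBall hgen m (D + 1), ← ncard_distBall hgen m D, ← Set.ncard_prod]
  exact Set.ncard_le_ncard (edgeCut_reachableOff_subset (cayleyGraph_connected hgen) m x D)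
    ((finite_distBall hA hgen m _).prod (finite_distBall hA hgen m _))

theorem mul_preimage_mem_optimalCuts {n : ℕ} (g : G) {C : Set G}
    (hC : C ∈ optimalCuts (cayleyGraph A) n) :
    (fun x => g * x) ⁻¹' C ∈ optimalCuts (cayleyGraph A) n :=
  preimage_mem_optimalCuts (f := Equiv.mulLeft g) (fun x y => cayleyGraph_adj_mul_left g x y) hC

theorem isNestedFamily_optimalCuts (hgen : Subgroup.closure A = ⊤) (n : ℕ) :
    IsNestedFamily (optimalCuts (cayleyGraph A) n) where
  compl_mem := compl_mem_optimalCuts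
  nonempty := nonempty_of_mem_optimalCuts
  nested := by
    intro C D hC hD
    have h := not_cross_of_mem_optimalCuts (cayleyGraph_connected hgen) hC hD
    by_contra! hcon
    obtain ⟨h1, h2, h3, h4⟩ := hcon
    rw [Set.not_subset] at h1 h2 h3 h4
    obtain ⟨a, ha, ha'⟩ := h1
    obtain ⟨b, hb, hb'⟩ := h2
    obtain ⟨c, hc, hc'⟩ := h3
    obtain ⟨d, hd, hd'⟩ := h4
    exact h ⟨⟨c, hc, by simpa using hc'⟩, ⟨a, ha, ha'⟩, ⟨b, hb', hb⟩, ⟨d, hd, hd'⟩⟩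
  finite := finite_optimalCuts_separating (cayleyGraph_connected hgen)

end Group

section Split

variable {G : Type*} [Group G] {A : Set G}

/-- A family of vertices indexed by `ℤ` is geodesic on `[-L, L]`. -/
def GeodesicOn (A : Set G) (α : ℤ → G) (L : ℕ) : Prop :=
  ∀ i j : ℤ, |i| ≤ L → |j| ≤ L → ((cayleyGraph A).dist (α i) (α j) : ℤ) = |i - j|

theorem mem_reachableOff_of_geodesic {D : ℕ} {a : ℤ → G}
    (ha : ∀ i j, ((cayleyGraph A).dist (a i) (a j) : ℤ) = |i - j|) (k : ℕ) :
    a (D + 1 + k : ℕ) ∈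
      reachableOff (cayleyGraph A) (distBall (cayleyGraph A) (a 0) D) (a (D + 1 : ℕ)) := by
  have hoff : ∀ k : ℕ, a (D + 1 + k : ℕ) ∉ distBall (cayleyGraph A) (a 0) D := by
    intro k hk
    have h1 : (cayleyGraph A).dist (a 0) (a (D + 1 + k : ℕ)) ≤ D := hk
    have h2 := ha 0 (D + 1 + k : ℕ)
    rw [zero_sub, abs_neg, Nat.abs_cast] at h2
    omega
  induction k with
  | zero => exact ⟨SimpleGraph.Walk.nil, by simpa using hoff 0⟩
  | succ k ih =>
    refine reachableOff_of_adj ih ?_ (hoff (k + 1))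
    rw [← SimpleGraph.dist_eq_one_iff_adj]
    have h := ha (D + 1 + k : ℕ) (D + 1 + (k + 1) : ℕ)
    push_cast at h ⊢
    rw [show ((D : ℤ) + 1 + k - (D + 1 + (k + 1))) = -1 by ring] at h
    simpa using h

theorem neg_notMem_reachableOff_of_geodesic {D : ℕ} (hD : Bottleneck (cayleyGraph A) D)
    {a : ℤ → G} (ha : ∀ i j, ((cayleyGraph A).dist (a i) (a j) : ℤ) = |i - j|) (k : ℕ) :
    a (-k) ∉
      reachableOff (cayleyGraph A) (distBall (cayleyGraph A) (a 0) D) (a (D + 1 : ℕ)) := by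
  rintro ⟨w, hw⟩
  have h1 := ha (D + 1 : ℕ) 0
  have h2 := ha 0 (-k)
  have h3 := ha (D + 1 : ℕ) (-k)
  rw [sub_zero, Nat.abs_cast] at h1
  rw [zero_sub, neg_neg, Nat.abs_cast] at h2
  rw [sub_neg_eq_add, ← Nat.cast_add, Nat.abs_cast] at h3
  obtain ⟨p, hp, hpD⟩ := hD w (z := a 0) (by omega)
  exact hw p hp hpD

theorem exists_limit_geodesic (hA : A.Finite) (hgen : Subgroup.closure A = ⊤) {β : ℕ → ℤ → G}
    (hβ : ∀ L, GeodesicOn A (β L) L) (h0 : ∀ L, β L 0 = 1) :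
    ∃ a : ℤ → G, (∀ i j, ((cayleyGraph A).dist (a i) (a j) : ℤ) = |i - j|) ∧
      ∀ i, ∀ᶠ L in (Filter.hyperfilter ℕ : Filter ℕ), β L i = a i := by
  have hlarge : ∀ i : ℤ, ∀ᶠ L : ℕ in (Filter.hyperfilter ℕ : Filter ℕ), |i| ≤ (L : ℤ) := by
    intro i
    refine Filter.Eventually.filter_mono Nat.hyperfilter_le_atTop ?_
    filter_upwards [Filter.eventually_ge_atTop i.natAbs] with L hL
    rw [Int.abs_eq_natAbs]
    exact_mod_cast hL
  have hlim : ∀ i : ℤ, ∃ x, ∀ᶠ L in (Filter.hyperfilter ℕ : Filter ℕ), β L i = x := by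
    intro i
    have hev : (⋃ x ∈ distBall (cayleyGraph A) 1 i.natAbs, {L | β L i = x}) ∈
        Filter.hyperfilter ℕ := by
      filter_upwards [hlarge i] with L hL
      simp only [Set.mem_iUnion]
      refine ⟨β L i, ?_, rfl⟩
      have h := hβ L 0 i (by simp) hL
      rw [h0, zero_sub, abs_neg, Int.abs_eq_natAbs] at h
      show (cayleyGraph A).dist 1 (β L i) ≤ i.natAbs
      exact_mod_cast h.le
    obtain ⟨x, -, hx⟩ := (Ultrafilter.finite_biUnion_mem_iff (finite_distBall hA hgen _ _)).1 hev
    exact ⟨x, hx⟩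
  choose a ha using hlim
  refine ⟨a, fun i j => ?_, ha⟩
  obtain ⟨L, hi, hj, hi', hj'⟩ :=
    ((ha i).and ((ha j).and ((hlarge i).and (hlarge j)))).exists
  rw [← hi, ← hj]
  exact hβ L i j hi' hj'

theorem exists_optimalCut_of_geodesic (hA : A.Finite) (hgen : Subgroup.closure A = ⊤) {D : ℕ}
    (hD : Bottleneck (cayleyGraph A) D) {a : ℤ → G}
    (ha : ∀ i j, ((cayleyGraph A).dist (a i) (a j) : ℤ) = |i - j|) :
    ∃ E ∈ optimalCuts (cayleyGraph A)
        ((distBall (cayleyGraph A) 1 (D + 1)).ncard * (distBall (cayleyGraph A) 1 D).ncard),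
      {k : ℕ | a k ∈ E}.Infinite ∧ {k : ℕ | a (-k) ∉ E}.Infinite := by
  obtain ⟨E, hE, hE1, hE2⟩ := exists_mem_optimalCuts
    (finite_edgeCut_reachableOff hA hgen (a 0) (a (D + 1 : ℕ)) D)
    (ncard_edgeCut_reachableOff_le hA hgen (a 0) (a (D + 1 : ℕ)) D)
    (U := (Filter.hyperfilter ℕ).map fun k : ℕ => a k)
    (W := (Filter.hyperfilter ℕ).map fun k : ℕ => a (-k)) (by
      rw [Ultrafilter.mem_map]
      refine Nat.hyperfilter_le_atTop ?_
      filter_upwards [Filter.eventually_ge_atTop (D + 1)] with k hk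
      obtain ⟨l, rfl⟩ := Nat.exists_eq_add_of_le hk
      exact mem_reachableOff_of_geodesic ha l) (by
      rw [← Ultrafilter.compl_mem_iff_notMem, Ultrafilter.mem_map]
      exact Filter.univ_mem' fun k => neg_notMem_reachableOff_of_geodesic hD ha k)
  refine ⟨E, hE, fun h => h.notMem_hyperfilter hE1, fun h => ?_⟩
  rw [← Ultrafilter.compl_mem_iff_notMem] at hE2
  exact h.notMem_hyperfilter hE2

theorem le_ncard_of_injective_cast {s : Set ℤ} (hs : s.Finite) {f : ℕ → ℤ}
    (hf : Function.Injective f) {F : Finset ℕ} (hF : ∀ k ∈ F, f k ∈ s) : F.card ≤ s.ncard := by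
  rw [← Set.ncard_coe_finset, ← Set.ncard_image_of_injective _ hf]
  refine Set.ncard_le_ncard ?_ hs
  rintro _ ⟨k, hk, rfl⟩
  exact hF k hk

/-- Every sufficiently long geodesic is split by an optimal cut into two large parts. -/
theorem exists_optimalCut_split (hA : A.Finite) (hgen : Subgroup.closure A = ⊤) {D : ℕ}
    (hD : Bottleneck (cayleyGraph A) D) (M : ℕ) :
    ∃ L : ℕ, ∀ α : ℤ → G, GeodesicOn A α L → ∃ E ∈ optimalCuts (cayleyGraph A)
        ((distBall (cayleyGraph A) 1 (D + 1)).ncard * (distBall (cayleyGraph A) 1 D).ncard),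
      M ≤ {i : ℤ | |i| ≤ L ∧ α i ∈ E}.ncard ∧ M ≤ {i : ℤ | |i| ≤ L ∧ α i ∉ E}.ncard := by
  by_contra! hcon
  choose α hα hbad using hcon
  obtain ⟨a, ha, hlim⟩ := exists_limit_geodesic hA hgen (β := fun L i => (α L 0)⁻¹ * α L i)
    (fun L i j hi hj => by
      rw [dist_mul_left hgen]
      exact hα L i j hi hj) (fun L => by simp)
  obtain ⟨E, hE, hE1, hE2⟩ := exists_optimalCut_of_geodesic hA hgen hD ha
  obtain ⟨F, hF, hFM⟩ := hE1.exists_subset_card_eq M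
  obtain ⟨F', hF', hFM'⟩ := hE2.exists_subset_card_eq M
  have hlarge : ∀ k : ℕ, ∀ᶠ L in (Filter.hyperfilter ℕ : Filter ℕ), k ≤ L := fun k =>
    Filter.Eventually.filter_mono Nat.hyperfilter_le_atTop (Filter.eventually_ge_atTop k)
  have h1 : ∀ᶠ L in (Filter.hyperfilter ℕ : Filter ℕ),
      ∀ k ∈ F, (α L 0)⁻¹ * α L k = a k ∧ k ≤ L :=
    (Filter.eventually_all_finset F).2 fun k _ => (hlim k).and (hlarge k)
  have h2 : ∀ᶠ L in (Filter.hyperfilter ℕ : Filter ℕ),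
      ∀ k ∈ F', (α L 0)⁻¹ * α L (-k) = a (-k) ∧ k ≤ L :=
    (Filter.eventually_all_finset F').2 fun k _ => (hlim (-k)).and (hlarge k)
  obtain ⟨L, hL1, hL2⟩ := (h1.and h2).exists
  have hfin : ∀ p : ℤ → Prop, {i : ℤ | |i| ≤ L ∧ p i}.Finite := fun p =>
    (Set.finite_Icc (-(L : ℤ)) L).subset fun i hi => abs_le.1 hi.1
  have hM1 : M ≤ {i : ℤ | |i| ≤ L ∧ α L i ∈ (fun x => (α L 0)⁻¹ * x) ⁻¹' E}.ncard := by
    rw [← hFM]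
    refine le_ncard_of_injective_cast (hfin _) Nat.cast_injective fun k hk => ⟨?_, ?_⟩
    · simpa using (hL1 k hk).2
    · show (α L 0)⁻¹ * α L k ∈ E
      rw [(hL1 k hk).1]
      exact hF hk
  refine (hbad L _ (mul_preimage_mem_optimalCuts (α L 0)⁻¹ hE) hM1).not_ge ?_
  rw [← hFM']
  refine le_ncard_of_injective_cast (hfin _) (f := fun k : ℕ => -(k : ℤ))
    (fun k l h => by simpa using h) fun k hk => ⟨?_, ?_⟩
  · simpa using (hL2 k hk).2
  · show (α L 0)⁻¹ * α L (-k) ∉ E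
    rw [(hL2 k hk).1]
    exact hF' hk

end Split

section Anchors

variable {G : Type*} [Group G] {A : Set G}

/-- The vertices within distance `1` of every member of `O`. -/
def anchors (A : Set G) (O : Set (Set G)) : Set G :=
  {x | ∀ C ∈ O, ∃ c ∈ C, (cayleyGraph A).dist x c ≤ 1}

theorem mul_mem_anchors (hgen : Subgroup.closure A = ⊤) (g : G) (O : Set (Set G)) {x : G}
    (hx : x ∈ anchors A O) : g * x ∈ anchors A {C | (fun x => g * x) ⁻¹' C ∈ O} := by
  intro C hC
  obtain ⟨c, hc, hxc⟩ := hx _ hC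
  exact ⟨g * c, hc, by rwa [dist_mul_left hgen]⟩

theorem anchors_nonempty (hgen : Subgroup.closure A = ⊤) {n : ℕ} {O : Set (Set G)}
    (hO : IsOrientation (optimalCuts (cayleyGraph A) n) 1 O) : (anchors A O).Nonempty := by
  have h𝓔 := isNestedFamily_optimalCuts hgen n
  by_cases hroot : O = {C | C ∈ optimalCuts (cayleyGraph A) n ∧ (1 : G) ∈ C}
  · refine ⟨1, fun C hC => ⟨1, ?_, by simp⟩⟩
    rw [hroot] at hC
    exact hC.2
  obtain ⟨C, ⟨hC, h1C⟩, hleast⟩ := hO.exists_least h𝓔 hroot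
  obtain ⟨⟨x, y⟩, hxy, hx, hy⟩ := edgeCut_nonempty (cayleyGraph_connected hgen)
    (h𝓔.nonempty (hO.subset hC)) ⟨1, h1C⟩
  have hxy1 : (cayleyGraph A).dist x y = 1 := SimpleGraph.dist_eq_one_iff_adj.2 hxy
  refine ⟨x, fun C' hC' => ?_⟩
  rcases h𝓔.nested (hO.subset hC) (hO.subset hC') with h | h | h | h
  · exact ⟨x, h hx, by simp⟩
  · exact ⟨x, hleast C' hC' (fun h1 => h1C (h h1)) hx, by simp⟩
  · exact absurd h (hO.not_subset_compl h𝓔 hC hC')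
  · exact ⟨y, h hy, hxy1.le⟩

theorem dist_le_of_mem_support {V : Type*} {Γ : SimpleGraph V} {x y p : V} (w : Γ.Walk x y)
    (hp : p ∈ w.support) : Γ.dist p y ≤ w.length ∧ Γ.dist x p ≤ w.length := by
  classical
  exact ⟨(Γ.dist_le (w.dropUntil p hp)).trans (w.length_dropUntil_le_length hp),
    (Γ.dist_le (w.takeUntil p hp)).trans (w.length_takeUntil_le_length hp)⟩

theorem exists_near_of_mem_anchors (hgen : Subgroup.closure A = ⊤) {D n : ℕ}
    (hD : Bottleneck (cayleyGraph A) D) {O : Set (Set G)}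
    (hO : O ⊆ optimalCuts (cayleyGraph A) n) {s t z : G} (hs : s ∈ anchors A O)
    (ht : t ∈ anchors A O)
    (hz : (cayleyGraph A).dist s z + (cayleyGraph A).dist z t = (cayleyGraph A).dist s t)
    {C : Set G} (hC : C ∈ O) : ∃ c ∈ C, (cayleyGraph A).dist z c ≤ D + 1 := by
  have hΓ := cayleyGraph_connected hgen
  obtain ⟨s', hs', hss'⟩ := hs C hC
  obtain ⟨t', ht', htt'⟩ := ht C hC
  obtain ⟨w, hw⟩ := (connectedSet_of_mem_optimalCuts hΓ (hO hC)).exists_walk hs' ht'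
  obtain ⟨u, hu⟩ := hΓ.exists_walk_length_eq_dist s s'
  obtain ⟨v, hv⟩ := hΓ.exists_walk_length_eq_dist t' t
  obtain ⟨p, hp, hpz⟩ := hD ((u.append w).append v) hz
  rw [SimpleGraph.Walk.mem_support_append_iff, SimpleGraph.Walk.mem_support_append_iff] at hp
  rcases hp with (hp | hp) | hp
  · refine ⟨s', hs', (hΓ.dist_triangle (v := p)).trans ?_⟩
    have := (dist_le_of_mem_support u hp).1
    omega
  · exact ⟨p, hw p hp, by omega⟩
  · refine ⟨t', ht', (hΓ.dist_triangle (v := p)).trans ?_⟩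
    have := (dist_le_of_mem_support v hp).2
    rw [SimpleGraph.dist_comm] at this htt'
    omega

theorem GeodesicOn.ncard_notMem_le (hA : A.Finite) (hgen : Subgroup.closure A = ⊤) {α : ℤ → G}
    {L r : ℕ} (hα : GeodesicOn A α L) {C : Set G} (hC : (edgeCut (cayleyGraph A) C).Finite)
    (h : ∀ i : ℤ, |i| ≤ L → ∃ c ∈ C, (cayleyGraph A).dist (α i) c ≤ r) :
    {i : ℤ | |i| ≤ L ∧ α i ∉ C}.ncard ≤
      (edgeCut (cayleyGraph A) C).ncard * (distBall (cayleyGraph A) 1 r).ncard := by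
  have hΓ := cayleyGraph_connected hgen
  have hinj : Set.InjOn α {i : ℤ | |i| ≤ L ∧ α i ∉ C} := by
    intro i hi j hj hij
    have hd := hα i j hi.1 hj.1
    rw [hij, SimpleGraph.dist_self, Nat.cast_zero, eq_comm, abs_eq_zero, sub_eq_zero] at hd
    exact hd
  have hfin := hC.prod (finite_distBall hA hgen 1 r)
  rw [← hinj.ncard_image, ← Set.ncard_prod]
  refine le_trans (Set.ncard_le_ncard (t := (fun q : (G × G) × G => q.1.1 * q.2) ''
    (edgeCut (cayleyGraph A) C ×ˢ distBall (cayleyGraph A) 1 r)) ?_ (hfin.image _))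
    (Set.ncard_image_le hfin)
  rintro _ ⟨i, ⟨hi, hiC⟩, rfl⟩
  obtain ⟨c, hc, hic⟩ := h i hi
  obtain ⟨w, hw⟩ := hΓ.exists_walk_length_eq_dist c (α i)
  obtain ⟨d, hd, hd1, hd2⟩ := w.exists_boundary_dart C hc hiC
  have hdist := (dist_le_of_mem_support w (w.dart_fst_mem_support_of_mem_darts hd)).1
  refine ⟨((d.fst, d.snd), d.fst⁻¹ * α i), ⟨⟨d.adj, hd1, hd2⟩, ?_⟩, by simp⟩
  show (cayleyGraph A).dist 1 (d.fst⁻¹ * α i) ≤ r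
  have h1 := dist_mul_left hgen d.fst⁻¹ d.fst (α i)
  rw [inv_mul_cancel] at h1
  rw [h1]
  rw [SimpleGraph.dist_comm] at hw
  omega

theorem geodesicOn_getVert (hgen : Subgroup.closure A = ⊤) {s t : G}
    {w : (cayleyGraph A).Walk s t} (hw : w.length = (cayleyGraph A).dist s t) {L : ℕ}
    (hL : 2 * L ≤ w.length) : GeodesicOn A (fun i : ℤ => w.getVert (L + i).toNat) L := by
  intro i j hi hj
  rw [abs_le] at hi hj
  rw [dist_getVert (cayleyGraph_connected hgen) hw (by omega) (by omega),
    Int.toNat_of_nonneg (by omega), Int.toNat_of_nonneg (by omega), add_sub_add_left_eq_sub]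

/-- The sets of anchors of orientations are uniformly bounded. -/
theorem exists_dist_anchors_le (hA : A.Finite) (hgen : Subgroup.closure A = ⊤) {D : ℕ}
    (hD : Bottleneck (cayleyGraph A) D) : ∃ n R : ℕ, ∀ O,
      IsOrientation (optimalCuts (cayleyGraph A) n) 1 O →
      ∀ s ∈ anchors A O, ∀ t ∈ anchors A O, (cayleyGraph A).dist s t ≤ R := by
  have hΓ := cayleyGraph_connected hgen
  set n := (distBall (cayleyGraph A) 1 (D + 1)).ncard * (distBall (cayleyGraph A) 1 D).ncard
  obtain ⟨L, hL⟩ := exists_optimalCut_split hA hgen hD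
    (n * (distBall (cayleyGraph A) 1 (D + 1)).ncard + 1)
  refine ⟨n, 2 * L, fun O hO s hs t ht => ?_⟩
  by_contra! hlong
  obtain ⟨w, hw⟩ := hΓ.exists_walk_length_eq_dist s t
  have hα := geodesicOn_getVert hgen hw (L := L) (by omega)
  have key : ∀ C ∈ O, {i : ℤ | |i| ≤ L ∧ w.getVert (L + i).toNat ∉ C}.ncard ≤
      n * (distBall (cayleyGraph A) 1 (D + 1)).ncard := by
    intro C hC
    have hCopt := hO.subset hC
    refine (hα.ncard_notMem_le hA hgen hCopt.1 (r := D + 1) fun i hi => ?_).trans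
      (Nat.mul_le_mul_right _ hCopt.2.1)
    refine exists_near_of_mem_anchors hgen hD hO.subset hs ht ?_ hC
    rw [abs_le] at hi
    obtain ⟨k, hk⟩ : ∃ k, (L + i).toNat + k = w.length :=
      ⟨w.length - (L + i).toNat, by omega⟩
    have h1 := dist_getVert_add hΓ hw (i := 0) (k := (L + i).toNat) (by omega)
    have h2 := dist_getVert_add hΓ hw (i := (L + i).toNat) (k := k) hk.le
    rw [zero_add, w.getVert_zero] at h1
    rw [hk, w.getVert_length] at h2
    omega
  obtain ⟨E, hE, h1, h2⟩ := hL _ hα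
  rcases hO.mem_or_compl_mem hE with hEO | hEO
  · exact absurd (key E hEO) (by omega)
  · have := key _ hEO
    simp only [Set.mem_compl_iff, not_not] at this
    omega

theorem virtuallyFree_of_bottleneck (hA : A.Finite) (hgen : Subgroup.closure A = ⊤) {D : ℕ}
    (hD : Bottleneck (cayleyGraph A) D) : VirtuallyFree G := by
  obtain ⟨n, R, hR⟩ := exists_dist_anchors_le hA hgen hD
  refine virtuallyFree_of_isNestedFamily (isNestedFamily_optimalCuts hgen n)
    (fun g C hC => mul_preimage_mem_optimalCuts g hC) (anchors A)
    (b := (distBall (cayleyGraph A) 1 R).ncard) (fun O hO => anchors_nonempty hgen hO)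
    (fun g O x hx => mul_mem_anchors hgen g O hx) fun O hO => ?_
  obtain ⟨s, hs⟩ := anchors_nonempty hgen hO
  have hsub : anchors A O ⊆ distBall (cayleyGraph A) s R := fun t ht => hR O hO s hs t ht
  have hfin := finite_distBall hA hgen s R
  exact ⟨hfin.subset hsub, (Set.ncard_le_ncard hsub hfin).trans (ncard_distBall hgen s R).le⟩

end Anchors

end VirtuallyFreePolygons

/-- A group `G` generated by a finite set `A` is virtually free if and only if there
exists `δ ≥ 0` such that every discrete geodesic polygon in `G` is `δ`-thin: every
vertex of the last side is within word-metric distance `δ` of some vertex of the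
other sides. -/
theorem virtuallyFree_iff_discrete_polygons_thin {G : Type*} [Group G]
    (A : Set G) (hA : A.Finite) (hgen : Subgroup.closure A = ⊤) :
    VirtuallyFree G ↔
      ∃ δ : ℝ, 0 ≤ δ ∧ ∀ P : DiscPolygon G A, ∀ t ≤ P.m P.n,
        ∃ j < P.n, ∃ u ≤ P.m j, (wordDist A (P.γ P.n t) (P.γ j u) : ℝ) ≤ δ := by
  constructor
  · exact VirtuallyFreePolygons.thin_of_virtuallyFree A hA hgen
  · rintro ⟨δ, -, h⟩
    exact VirtuallyFreePolygons.virtuallyFree_of_bottleneck hA hgen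
      (VirtuallyFreePolygons.bottleneck_of_thin hgen h)
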